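/- Let sigma and sigma' be weights of K with chi_sigma different from chi_sigma^s and chi_{sigma'} = chi_sigma^s. Then Hom_G(ind_K^G sigma, ind_K^G sigma') = 0. In particular, for a weight sigma with chi_sigma ≠ chi_sigma^s, the compact induction ind_K^G sigma contains no weight sigma' with chi_{sigma'} = chi_sigma^s. -/

import Mathlib

open scoped Classical

noncomputable section

namespace U21

/-- The arithmetic setting: `E` is the unramified quadratic extension of a non-archimedean
local field `F` of odd residue characteristic `p`, with residue field of `F` of cardinality
`q = p ^ fdeg`.  The field `E` is encoded through its valuation subring `O = o_E`, a
uniformizer `ϖ`, the maximal ideal `mI` (so that `p_E^k` is `ϖ ^ k * O`), and the nontrivial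
`F`-automorphism `conj` of `E` (which induces the `q`-power Frobenius on the residue field
of `E`, of cardinality `q ^ 2`). -/
structure Setting where
  p : ℕ
  q : ℕ
  fdeg : ℕ
  hp : p.Prime
  hodd : p ≠ 2
  hfdeg : 0 < fdeg
  hq : q = p ^ fdeg
  E : Type
  [fieldE : Field E]
  conj : E →+* E
  conj_invol : ∀ x, conj (conj x) = x
  conj_ne : conj ≠ RingHom.id E
  O : Subring E
  val_ring : ∀ x : E, x ≠ 0 → x ∈ O ∨ x⁻¹ ∈ O
  conj_O : ∀ x, x ∈ O → conj x ∈ O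
  ϖ : E
  unif_mem : ϖ ∈ O
  unif_ne : ϖ ≠ 0
  unif_conj : conj ϖ = ϖ
  unif_not_unit : ¬ IsUnit (⟨ϖ, unif_mem⟩ : O)
  disc : ∀ x : E, x ≠ 0 → ∃ (n : ℤ) (u : Oˣ), x = (u : O) * ϖ ^ n
  mI : Ideal O
  hmI : ∀ x : O, x ∈ mI ↔ ∃ y ∈ O, (x : E) = ϖ * y
  [fin_res : Fintype (O ⧸ mI)]
  card_res : Fintype.card (O ⧸ mI) = q ^ 2
  res_frob : ∀ x : O, Ideal.Quotient.mk mI ⟨conj x, conj_O x x.2⟩ = (Ideal.Quotient.mk mI x) ^ q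
  complete : ∀ a : ℕ → E,
    (∀ k : ℕ, ∃ N, ∀ m ≥ N, ∀ n ≥ N, ∃ w ∈ O, a m - a n = ϖ ^ k * w) →
    ∃ L : E, ∀ k : ℕ, ∃ N, ∀ n ≥ N, ∃ w ∈ O, a n - L = ϖ ^ k * w

attribute [instance] Setting.fieldE Setting.fin_res

namespace Setting

variable (S : Setting)

/-- 3×3 matrices over `E`. -/
abbrev M3 := Matrix (Fin 3) (Fin 3) S.E

/-- The antidiagonal matrix `β` of the Hermitian form. -/
def betaM : S.M3 := !![0,0,1;0,1,0;1,0,0]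

/-- The fractional ideal `p_E ^ k ⊆ E` (for `k : ℤ`). -/
def pE (k : ℤ) : Set S.E := {z | ∃ w ∈ S.O, z = S.ϖ ^ k * w}

/-- The unramified unitary group `G = U(2,1)(E/F)`, as a subgroup of `GL₃(E)`:
`g ∈ G` iff `g.transpose * β * conj g = β`. -/
def Gsub : Subgroup (Matrix.GeneralLinearGroup (Fin 3) S.E) where
  carrier := {g | ((g : S.M3)).transpose * S.betaM * ((g : S.M3).map S.conj) = S.betaM}
  one_mem' := by
    simp [Matrix.map_one (⇑S.conj) (map_zero S.conj) (map_one S.conj)]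
  mul_mem' := by
    intro a b ha hb
    simp only [Set.mem_setOf_eq, Units.val_mul, Matrix.transpose_mul, Matrix.map_mul] at ha hb ⊢
    calc ((b : S.M3)).transpose * ((a : S.M3)).transpose * S.betaM * ((a : S.M3).map S.conj * (b : S.M3).map S.conj)
        = ((b : S.M3)).transpose * (((a : S.M3)).transpose * S.betaM * (a : S.M3).map S.conj) * ((b : S.M3).map S.conj) := by
          simp only [mul_assoc]
      _ = S.betaM := by rw [ha]; exact hb
  inv_mem' := by
    intro a ha
    simp only [Set.mem_setOf_eq] at ha ⊢
    have hA : IsUnit ((a : S.M3)) := a.isUnit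
    have hdet : IsUnit ((a : S.M3)).det := (Matrix.isUnit_iff_isUnit_det _).mp hA
    have hAc : IsUnit (((a : S.M3)).map ⇑S.conj) := by
      rw [← RingHom.mapMatrix_apply]; exact hA.map _
    have hdetc : IsUnit ((((a : S.M3)).map ⇑S.conj).det) := (Matrix.isUnit_iff_isUnit_det _).mp hAc
    have hdetT : IsUnit ((((a : S.M3)).transpose).det) := by rw [Matrix.det_transpose]; exact hdet
    have hmapinv : ((a : S.M3)⁻¹).map ⇑S.conj = (((a : S.M3)).map ⇑S.conj)⁻¹ := by
      symm
      apply Matrix.inv_eq_left_inv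
      rw [← Matrix.map_mul, Matrix.nonsing_inv_mul _ hdet,
        Matrix.map_one (⇑S.conj) (map_zero S.conj) (map_one S.conj)]
    rw [Matrix.coe_units_inv, Matrix.transpose_nonsing_inv, hmapinv]
    conv_lhs => rw [← ha]
    calc (((a:S.M3)).transpose)⁻¹ * (((a:S.M3)).transpose * S.betaM * ((a:S.M3)).map ⇑S.conj) * (((a:S.M3)).map ⇑S.conj)⁻¹
        = (((a:S.M3)).transpose)⁻¹ * ((a:S.M3)).transpose * S.betaM *
            (((a:S.M3)).map ⇑S.conj * (((a:S.M3)).map ⇑S.conj)⁻¹) := by simp only [mul_assoc]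
      _ = S.betaM := by
          rw [Matrix.nonsing_inv_mul _ hdetT, Matrix.mul_nonsing_inv _ hdetc, one_mul, mul_one]

/-- The group `G = U(2,1)(E/F)`. -/
abbrev GG := ↥S.Gsub

/-- The matrix of an element of `G`. -/
def mat (g : S.GG) : S.M3 := ((g : Matrix.GeneralLinearGroup (Fin 3) S.E) : S.M3)

/-- The upper unipotent matrix `n(x,y)`. -/
def nM (x y : S.E) : S.M3 := !![1, x, y; 0, 1, -S.conj x; 0, 0, 1]

/-- The lower unipotent matrix `n'(x,y)`. -/
def n'M (x y : S.E) : S.M3 := !![1, 0, 0; x, 1, 0; y, -S.conj x, 1]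

/-- The diagonal matrix `h(x) = diag(x, -x̄x⁻¹, x̄⁻¹)`. -/
def hM (x : S.E) : S.M3 := !![x, 0, 0; 0, -S.conj x * x⁻¹, 0; 0, 0, (S.conj x)⁻¹]

/-- The subgroup `N` of `G` (unipotent radical of the upper triangular Borel), as a set. -/
def Nset : Set S.GG := {g | ∃ x y : S.E, x * S.conj x + y + S.conj y = 0 ∧ S.mat g = S.nM x y}

/-- The subgroup `N_k = {n(x,y) : y ∈ p_E^k}`, as a set. -/
def Nk (k : ℤ) : Set S.GG :=
  {g | ∃ x y : S.E, x * S.conj x + y + S.conj y = 0 ∧ y ∈ S.pE k ∧ S.mat g = S.nM x y}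

/-- The subgroup `N'` of `G`, as a set. -/
def N'set : Set S.GG := {g | ∃ x y : S.E, x * S.conj x + y + S.conj y = 0 ∧ S.mat g = S.n'M x y}

/-- The subgroup `N'_k = {n'(x,y) : y ∈ p_E^k}`, as a set. -/
def N'k (k : ℤ) : Set S.GG :=
  {g | ∃ x y : S.E, x * S.conj x + y + S.conj y = 0 ∧ y ∈ S.pE k ∧ S.mat g = S.n'M x y}

/-- The diagonal subgroup `H` of `G`, as a set. -/
def Hset : Set S.GG := {g | ∃ a b c : S.E, S.mat g = !![a,0,0;0,b,0;0,0,c]}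

/-- The hyperspecial maximal compact subgroup `K₀ = G ∩ GL₃(o_E)`, as a set. -/
def K0set : Set S.GG := {g | ∀ i j, S.mat g i j ∈ S.O}

/-- The special (non-hyperspecial) maximal compact subgroup `K₁`, as a set. -/
def K1set : Set S.GG :=
  {g | S.mat g 0 0 ∈ S.O ∧ S.mat g 0 1 ∈ S.O ∧ S.mat g 0 2 ∈ S.pE (-1) ∧
       S.mat g 1 0 ∈ S.pE 1 ∧ S.mat g 1 1 ∈ S.O ∧ S.mat g 1 2 ∈ S.O ∧
       S.mat g 2 0 ∈ S.pE 1 ∧ S.mat g 2 1 ∈ S.pE 1 ∧ S.mat g 2 2 ∈ S.O}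

/-- The Iwahori subgroup `I_{K₀}` (preimage of the Borel of `Γ_{K₀}`), as a set. -/
def IK0 : Set S.GG :=
  {g | g ∈ S.K0set ∧ S.mat g 1 0 ∈ S.pE 1 ∧ S.mat g 2 0 ∈ S.pE 1 ∧ S.mat g 2 1 ∈ S.pE 1}

/-- The pro-p Iwahori subgroup `I_{1,K₀}`, as a set. -/
def I1K0 : Set S.GG :=
  {g | g ∈ S.IK0 ∧ S.mat g 0 0 - 1 ∈ S.pE 1 ∧ S.mat g 1 1 - 1 ∈ S.pE 1 ∧ S.mat g 2 2 - 1 ∈ S.pE 1}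

/-- The opposite pro-p Iwahori subgroup `I'_{1,K₀}`, as a set. -/
def I1'K0 : Set S.GG :=
  {g | g ∈ S.K0set ∧ S.mat g 0 1 ∈ S.pE 1 ∧ S.mat g 0 2 ∈ S.pE 1 ∧ S.mat g 1 2 ∈ S.pE 1 ∧
       S.mat g 0 0 - 1 ∈ S.pE 1 ∧ S.mat g 1 1 - 1 ∈ S.pE 1 ∧ S.mat g 2 2 - 1 ∈ S.pE 1}

/-- The maximal normal pro-p subgroup `K₀¹` of `K₀` (principal congruence subgroup), as a set. -/
def Kone0 : Set S.GG := {g | ∀ i j, S.mat g i j - (1 : S.M3) i j ∈ S.pE 1}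

/-- The Iwahori subgroup `I_{K₁}`, as a set. -/
def IK1 : Set S.GG := {g | g ∈ S.K1set ∧ S.mat g 2 0 ∈ S.pE 2}

/-- The pro-p Iwahori subgroup `I_{1,K₁}`, as a set. -/
def I1K1 : Set S.GG :=
  {g | g ∈ S.IK1 ∧ S.mat g 0 0 - 1 ∈ S.pE 1 ∧ S.mat g 1 1 - 1 ∈ S.pE 1 ∧ S.mat g 2 2 - 1 ∈ S.pE 1}

/-- The opposite pro-p Iwahori subgroup `I'_{1,K₁}`, as a set. -/
def I1'K1 : Set S.GG :=
  {g | g ∈ S.K1set ∧ S.mat g 0 2 ∈ S.O ∧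
       S.mat g 0 0 - 1 ∈ S.pE 1 ∧ S.mat g 1 1 - 1 ∈ S.pE 1 ∧ S.mat g 2 2 - 1 ∈ S.pE 1}

/-- The maximal normal pro-p subgroup `K₁¹` of `K₁`, as a set. -/
def Kone1 : Set S.GG :=
  {g | g ∈ S.K1set ∧ S.mat g 0 2 ∈ S.O ∧ S.mat g 2 0 ∈ S.pE 2 ∧
       S.mat g 0 0 - 1 ∈ S.pE 1 ∧ S.mat g 1 1 - 1 ∈ S.pE 1 ∧ S.mat g 2 2 - 1 ∈ S.pE 1}

/-- The congruence subgroup of level `n` (used to express smoothness), as a set. -/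
def cong (n : ℕ) : Set S.GG := {g | ∀ i j, S.mat g i j - (1 : S.M3) i j ∈ S.pE n}

def alphaM : S.M3 := !![S.ϖ⁻¹, 0, 0; 0, 1, 0; 0, 0, S.ϖ]

def alphaMinv : S.M3 := !![S.ϖ, 0, 0; 0, 1, 0; 0, 0, S.ϖ⁻¹]

lemma alpha_mul_inv : S.alphaM * S.alphaMinv = 1 := by
  ext i j
  fin_cases i <;> fin_cases j <;>
    simp [alphaM, alphaMinv, Matrix.mul_apply, Fin.sum_univ_three, Matrix.one_apply,
      Matrix.vecHead, Matrix.vecTail, inv_mul_cancel₀ S.unif_ne, mul_inv_cancel₀ S.unif_ne]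

lemma alpha_inv_mul : S.alphaMinv * S.alphaM = 1 := by
  ext i j
  fin_cases i <;> fin_cases j <;>
    simp [alphaM, alphaMinv, Matrix.mul_apply, Fin.sum_univ_three, Matrix.one_apply,
      Matrix.vecHead, Matrix.vecTail, inv_mul_cancel₀ S.unif_ne, mul_inv_cancel₀ S.unif_ne]

def alphaU : Matrix.GeneralLinearGroup (Fin 3) S.E :=
  ⟨S.alphaM, S.alphaMinv, S.alpha_mul_inv, S.alpha_inv_mul⟩

lemma alphaU_mem : S.alphaU ∈ S.Gsub := by
  show ((S.alphaU : S.M3)).transpose * S.betaM * ((S.alphaU : S.M3).map S.conj) = S.betaM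
  have : (S.alphaU : S.M3) = S.alphaM := rfl
  rw [this]
  ext i j
  fin_cases i <;> fin_cases j <;>
    simp [alphaM, betaM, Matrix.mul_apply, Fin.sum_univ_three, Matrix.map_apply,
      Matrix.transpose_apply, Matrix.vecHead, Matrix.vecTail, map_inv₀, S.unif_conj,
      inv_mul_cancel₀ S.unif_ne, mul_inv_cancel₀ S.unif_ne]

/-- The element `α = diag(ϖ⁻¹, 1, ϖ)` of `G`. -/
def alphaE : S.GG := ⟨S.alphaU, S.alphaU_mem⟩

lemma beta_mul_beta : S.betaM * S.betaM = 1 := by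
  ext i j
  fin_cases i <;> fin_cases j <;>
    simp [betaM, Matrix.mul_apply, Fin.sum_univ_three, Matrix.one_apply,
      Matrix.vecHead, Matrix.vecTail]

def betaU : Matrix.GeneralLinearGroup (Fin 3) S.E :=
  ⟨S.betaM, S.betaM, S.beta_mul_beta, S.beta_mul_beta⟩

lemma betaU_mem : S.betaU ∈ S.Gsub := by
  show ((S.betaU : S.M3)).transpose * S.betaM * ((S.betaU : S.M3).map S.conj) = S.betaM
  have : (S.betaU : S.M3) = S.betaM := rfl
  rw [this]
  ext i j
  fin_cases i <;> fin_cases j <;>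
    simp [betaM, Matrix.mul_apply, Fin.sum_univ_three, Matrix.map_apply, Matrix.transpose_apply,
      Matrix.vecHead, Matrix.vecTail]

/-- The element `β` of `G`. -/
def betaE : S.GG := ⟨S.betaU, S.betaU_mem⟩

/-- The element `β' = β * α⁻¹` of `G`. -/
def betaPr : S.GG := S.betaE * S.alphaE⁻¹

/-- A finite set `U` is a set of representatives for the cosets `A/B`. -/
def IsReps (A B : Set S.GG) (U : Finset S.GG) : Prop :=
  (↑U : Set S.GG) ⊆ A ∧ ∀ a ∈ A, ∃! u, u ∈ U ∧ a⁻¹ * u ∈ B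

/-- The residue field `k_E` of `E`. -/
abbrev kE := S.O ⧸ S.mI

/-- The residue map `o_E → k_E`. -/
def resmap : S.O →+* S.kE := Ideal.Quotient.mk S.mI

/-- The group `L_{q³} = {(x,t) ∈ k_E² : x x̄ + t + t̄ = 0}` (where `x̄ = x^q`). -/
def Lbig : Set (S.kE × S.kE) := {z | z.1 * z.1 ^ S.q + z.2 + z.2 ^ S.q = 0}

/-- The group `L_q = {(0,t) ∈ k_E² : t + t̄ = 0}`. -/
def Lsmall : Set (S.kE × S.kE) := {z | z.1 = 0 ∧ z.2 + z.2 ^ S.q = 0}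

/-- `L_{q^t}` for `t ∈ {1,3}`. -/
def Lof (t : ℕ) : Set (S.kE × S.kE) := if t = 3 then S.Lbig else S.Lsmall

end Setting

/-- A choice of one of the two maximal compact open subgroups `K ∈ {K₀, K₁}` of `G`,
together with its maximal normal pro-p subgroup `K¹`, the (pro-p) Iwahori subgroups
`I_K ⊇ I_{1,K}`, the opposite pro-p Iwahori `I'_{1,K}`, the element
`β_K ∈ K ∩ {β, β'}`, and the integers `n_K, m_K, t_K`. -/
structure Chamber (S : Setting) where
  K : Subgroup S.GG
  KoneS : Set S.GG
  IK : Set S.GG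
  I1 : Set S.GG
  I1' : Set S.GG
  βK : S.GG
  nK : ℤ
  mK : ℤ
  tK : ℕ
  cases :
    ((K : Set S.GG) = S.K0set ∧ KoneS = S.Kone0 ∧ IK = S.IK0 ∧ I1 = S.I1K0 ∧ I1' = S.I1'K0 ∧
      βK = S.betaE ∧ nK = 0 ∧ mK = 1 ∧ tK = 3) ∨
    ((K : Set S.GG) = S.K1set ∧ KoneS = S.Kone1 ∧ IK = S.IK1 ∧ I1 = S.I1K1 ∧ I1' = S.I1'K1 ∧
      βK = S.betaPr ∧ nK = -1 ∧ mK = 2 ∧ tK = 1)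

namespace Chamber

variable {S : Setting} (C : Chamber S)

/-- `H₀ = H ∩ I_K`. -/
def H0 : Set S.GG := S.Hset ∩ C.IK

/-- `H₁ = H ∩ I_{1,K}`. -/
def H1 : Set S.GG := S.Hset ∩ C.I1

end Chamber

section RepTheory

variable {S : Setting} (C : Chamber S)
variable (𝔽 : Type) [Field 𝔽]

section Generic

variable {G₀ : Type} [Monoid G₀] {V : Type} [AddCommGroup V] [Module 𝔽 V]

/-- A submodule is invariant under a representation. -/
def Invt (ρ : Representation 𝔽 G₀ V) (Ssub : Submodule 𝔽 V) : Prop :=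
  ∀ g v, v ∈ Ssub → ρ g v ∈ Ssub

/-- The subrepresentation generated by a vector (the span of its orbit). -/
def orbitSpan (ρ : Representation 𝔽 G₀ V) (v : V) : Submodule 𝔽 V :=
  Submodule.span 𝔽 {w | ∃ g, w = ρ g v}

/-- The subrepresentation generated by a vector under a subset `A` of the group. -/
def orbitSpanOn (ρ : Representation 𝔽 G₀ V) (A : Set G₀) (v : V) : Submodule 𝔽 V :=
  Submodule.span 𝔽 {w | ∃ g ∈ A, w = ρ g v}

/-- The quotient of a representation by an invariant submodule `N` is irreducible:
equivalently (by the lattice correspondence), `N ≠ ⊤` and any invariant submodule lying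
between `N` and `⊤` equals `N` or `⊤`. -/
def QuotientIrreducible (ρ : Representation 𝔽 G₀ V) (N : Submodule 𝔽 V) : Prop :=
  N ≠ ⊤ ∧ ∀ Ssub : Submodule 𝔽 V, Invt 𝔽 ρ Ssub → N ≤ Ssub → Ssub = N ∨ Ssub = ⊤

/-- The submodule of vectors invariant under all elements of the subset `A`. -/
def invariantsOn (ρ : Representation 𝔽 G₀ V) (A : Set G₀) : Submodule 𝔽 V where
  carrier := {v | ∀ g ∈ A, ρ g v = v}
  add_mem' := by
    intro a b ha hb g hg
    rw [map_add, ha g hg, hb g hg]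
  zero_mem' := by
    intro g hg
    rw [map_zero]
  smul_mem' := by
    intro c a ha g hg
    rw [map_smul, ha g hg]

/-- The space `Hom_G(ρ₁, ρ₂)` of equivariant linear maps, as a submodule of the linear maps. -/
def EquivHomSub {V₂ : Type} [AddCommGroup V₂] [Module 𝔽 V₂]
    (ρ₁ : Representation 𝔽 G₀ V) (ρ₂ : Representation 𝔽 G₀ V₂) :
    Submodule 𝔽 (V →ₗ[𝔽] V₂) where
  carrier := {φ | ∀ g x, φ (ρ₁ g x) = ρ₂ g (φ x)}
  add_mem' := by
    intro a b ha hb g x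
    simp only [LinearMap.add_apply, ha g x, hb g x, map_add]
  zero_mem' := by
    intro g x
    simp only [LinearMap.zero_apply, map_zero]
  smul_mem' := by
    intro c a ha g x
    simp only [LinearMap.smul_apply, ha g x, map_smul]

end Generic

section Weight

variable (W : Type) [AddCommGroup W] [Module 𝔽 W]
variable (σ : Representation 𝔽 ↥C.K W)

/-- Extension of `σ` to all of `G` (by `1` outside `K`); used to avoid coercion issues. -/
def sigma' : S.GG → Module.End 𝔽 W := fun g => if h : g ∈ C.K then σ ⟨g, h⟩ else 1

/-- `σ` is a weight of `K`: an irreducible smooth representation of `K` over `𝔽`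
factoring through `Γ_K = K / K¹` (automatically finite dimensional). -/
def IsWeight : Prop :=
  Nontrivial W ∧ FiniteDimensional 𝔽 W ∧
  (∀ Ssub : Submodule 𝔽 W, (∀ (k : ↥C.K) (w : W), w ∈ Ssub → σ k w ∈ Ssub) → Ssub = ⊥ ∨ Ssub = ⊤) ∧
  (∀ (g : S.GG) (hg : g ∈ C.K), g ∈ C.KoneS → σ ⟨g, hg⟩ = LinearMap.id)

/-- `σ` is one dimensional of the form `χ ∘ det`. -/
def IsDetWeight : Prop :=
  Module.finrank 𝔽 W = 1 ∧
  ∃ c : S.E → 𝔽, ∀ (g : S.GG) (hg : g ∈ C.K) (w : W), σ ⟨g, hg⟩ w = c ((S.mat g).det) • w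

/-- `j_σ : σ → σ` is the composition of the coinvariant projection `σ → σ_{I'_{1,K}}`
with the inverse of the natural isomorphism `σ^{I_{1,K}} ≅ σ_{I'_{1,K}}`:
it restricts to the identity on `σ^{I_{1,K}}` and kills the augmentation part of
`σ` with respect to `I'_{1,K}`. -/
def IsJ (jσ : W →ₗ[𝔽] W) : Prop :=
  (∀ w : W, (∀ g ∈ C.I1, sigma' C 𝔽 W σ g w = w) → jσ w = w) ∧
  (∀ (w : W) (g : S.GG), g ∈ C.I1' → jσ (sigma' C 𝔽 W σ g w - w) = 0)

/-- The defining conditions of the compact induction `ind_K^G σ`: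
`K`-equivariance on the left and compact support (finitely many cosets `K g`). -/
def IndCarrier : Set (S.GG → W) :=
  {f | (∀ (k : S.GG) (hk : k ∈ C.K) (g : S.GG), f (k * g) = σ ⟨k, hk⟩ (f g)) ∧
       ∃ s : Finset S.GG, ∀ g : S.GG, f g ≠ 0 → ∃ k ∈ C.K, ∃ t ∈ s, g = k * t}

/-- The compact induction `ind_K^G σ`, as a submodule of `G → W`. -/
def IndSub : Submodule 𝔽 (S.GG → W) where
  carrier := IndCarrier C 𝔽 W σ
  add_mem' := by
    rintro f g ⟨hf1, sf, hf2⟩ ⟨hg1, sg, hg2⟩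
    refine ⟨fun k hk x => by simp [hf1 k hk x, hg1 k hk x], sf ∪ sg, fun x hx => ?_⟩
    by_cases h : f x ≠ 0
    · obtain ⟨k, hk, t, ht, rfl⟩ := hf2 x h
      exact ⟨k, hk, t, Finset.mem_union_left _ ht, rfl⟩
    · push_neg at h
      have hgx : g x ≠ 0 := by
        intro h0
        apply hx
        simp [Pi.add_apply, h, h0]
      obtain ⟨k, hk, t, ht, rfl⟩ := hg2 x hgx
      exact ⟨k, hk, t, Finset.mem_union_right _ ht, rfl⟩
  zero_mem' := ⟨fun k hk g => by simp, ∅, fun g hg => absurd rfl hg⟩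
  smul_mem' := by
    rintro c f ⟨hf1, sf, hf2⟩
    refine ⟨fun k hk g => by simp [hf1 k hk g], sf, fun x hx => ?_⟩
    refine hf2 x ?_
    intro h0
    apply hx
    simp [h0]

lemma indAct_mem (g : S.GG) {f : S.GG → W} (hf : f ∈ IndCarrier C 𝔽 W σ) :
    (fun x => f (x * g)) ∈ IndCarrier C 𝔽 W σ := by
  obtain ⟨h1, s, h2⟩ := hf
  refine ⟨fun k hk x => ?_, s.image (· * g⁻¹), ?_⟩
  · show f (k * x * g) = _
    rw [mul_assoc]
    exact h1 k hk (x * g)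
  intro x hx
  obtain ⟨k, hk, t, ht, hxg⟩ := h2 (x * g) hx
  refine ⟨k, hk, t * g⁻¹, Finset.mem_image_of_mem _ ht, ?_⟩
  rw [← mul_assoc, ← hxg, mul_assoc, mul_inv_cancel, mul_one]

/-- The representation of `G` on `ind_K^G σ` by right translation. -/
def indRep : Representation 𝔽 S.GG ↥(IndSub C 𝔽 W σ) where
  toFun g :=
    { toFun := fun f => ⟨fun x => (f : S.GG → W) (x * g), indAct_mem C 𝔽 W σ g f.2⟩
      map_add' := fun f1 f2 => Subtype.ext (funext fun x => rfl)
      map_smul' := fun c f => Subtype.ext (funext fun x => rfl) }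
  map_one' := LinearMap.ext fun f => Subtype.ext (funext fun x => by simp [mul_one])
  map_mul' g h := LinearMap.ext fun f => Subtype.ext (funext fun x => by simp [mul_assoc])

/-- The function `[g, v] ∈ ind_K^G σ`: supported on `K g⁻¹`, with value `v` at `g⁻¹`. -/
def stdFn (g : S.GG) (v : W) : S.GG → W :=
  fun x => if h : x * g ∈ C.K then σ ⟨x * g, h⟩ v else 0

/-- The characterization of the family `f_n` (`n ∈ ℤ`) of `I_{1,K}`-invariant elements of
`ind_K^G σ`: `f_n` is supported on `K α⁻ⁿ I_{1,K}` and has value at `α⁻ⁿ` equal to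
`σ(β_K) v₀` for `n > 0` and `v₀` for `n ≤ 0`, where `v₀` is a fixed nonzero vector of
`σ^{I_{1,K}}`. -/
def IsFFamily (v0 : W) (ff : ℤ → ↥(IndSub C 𝔽 W σ)) : Prop :=
  v0 ≠ 0 ∧ (∀ g ∈ C.I1, sigma' C 𝔽 W σ g v0 = v0) ∧
  (∀ (n : ℤ) (g : S.GG), g ∈ C.I1 → indRep C 𝔽 W σ g (ff n) = ff n) ∧
  (∀ (n : ℤ) (x : S.GG), (ff n : S.GG → W) x ≠ 0 →
    ∃ k ∈ C.K, ∃ i ∈ C.I1, x = k * S.alphaE ^ (-n) * i) ∧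
  (∀ n : ℤ, 0 < n → (ff n : S.GG → W) (S.alphaE ^ (-n)) = sigma' C 𝔽 W σ C.βK v0) ∧
  (∀ n : ℤ, n ≤ 0 → (ff n : S.GG → W) (S.alphaE ^ (-n)) = v0)

/-- The characterization of the Hecke operator `T ∈ End_G(ind_K^G σ)`:
it is `G`-equivariant and satisfies
`T [1, v] = ∑_{u ∈ N_{n_K}/N_{n_K+2}} [u α⁻¹, j_σ σ(u⁻¹) v]
  + ∑_{u ∈ N_{n_K+1}/N_{n_K+2}} [β_K u α⁻¹, j_σ σ(β_K) v]`. -/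
def IsHeckeT (jσ : W →ₗ[𝔽] W) (T : Module.End 𝔽 ↥(IndSub C 𝔽 W σ)) : Prop :=
  (∀ (g : S.GG) (x : ↥(IndSub C 𝔽 W σ)),
    T (indRep C 𝔽 W σ g x) = indRep C 𝔽 W σ g (T x)) ∧
  (∀ (v : W) (x : ↥(IndSub C 𝔽 W σ)), (x : S.GG → W) = stdFn C 𝔽 W σ 1 v →
    ∀ (U2 U1 : Finset S.GG),
      S.IsReps (S.Nk C.nK) (S.Nk (C.nK + 2)) U2 →
      S.IsReps (S.Nk (C.nK + 1)) (S.Nk (C.nK + 2)) U1 →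
      ((T x : S.GG → W)) =
        (∑ u ∈ U2, stdFn C 𝔽 W σ (u * S.alphaE⁻¹) (jσ (sigma' C 𝔽 W σ u⁻¹ v))) +
        ∑ u ∈ U1, stdFn C 𝔽 W σ (C.βK * u * S.alphaE⁻¹) (jσ (sigma' C 𝔽 W σ C.βK v)))

/-- The eigencharacter `χ_σ` of `H₀/H₁` afforded by the (one-dimensional) space
`σ^{I_{1,K}}` with chosen basis vector `v₀`. -/
def IsChi (v0 : W) (χ : S.GG → 𝔽) : Prop :=
  (∀ h ∈ C.H0, sigma' C 𝔽 W σ h v0 = χ h • v0)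

/-- Right translation on functions `K → 𝔽` (the action on a (finite) principal series). -/
def PSact (k : ↥C.K) (f : ↥C.K → 𝔽) : ↥C.K → 𝔽 := fun x => f (x * k)

/-- The (inflation to `K` of the) finite principal series `Ind_𝔹^{Γ_K} χ`:
functions on `K`, invariant under right translation by `K¹`, left `I_{1,K}`-invariant and
left `(H₀, χ)`-equivariant. -/
def PSchiSub (χ : S.GG → 𝔽) : Submodule 𝔽 (↥C.K → 𝔽) where
  carrier := {f | (∀ b : ↥C.K, (b : S.GG) ∈ C.I1 → ∀ x, f (b * x) = f x) ∧
                  (∀ h : ↥C.K, (h : S.GG) ∈ C.H0 → ∀ x, f (h * x) = χ (h : S.GG) * f x) ∧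
                  (∀ z : ↥C.K, (z : S.GG) ∈ C.KoneS → ∀ x, f (x * z) = f x)}
  add_mem' := by
    rintro f g ⟨hf1, hf2, hf3⟩ ⟨hg1, hg2, hg3⟩
    exact ⟨fun b hb x => by simp [hf1 b hb x, hg1 b hb x],
           fun h hh x => by simp [hf2 h hh x, hg2 h hh x, mul_add],
           fun z hz x => by simp [hf3 z hz x, hg3 z hz x]⟩
  zero_mem' := ⟨fun b hb x => rfl, fun h hh x => by simp, fun z hz x => rfl⟩
  smul_mem' := by
    rintro c f ⟨hf1, hf2, hf3⟩
    refine ⟨fun b hb x => by simp [hf1 b hb x], fun h hh x => ?_, fun z hz x => by simp [hf3 z hz x]⟩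
    simp only [Pi.smul_apply, hf2 h hh x, smul_eq_mul]
    ring

/-- The principal series `Ind_𝔹^{Γ_K} 1` for the trivial character. -/
def PS1sub : Submodule 𝔽 (↥C.K → 𝔽) := PSchiSub C 𝔽 (fun _ => 1)

/-- `σ_{st}` is the Steinberg weight `st = (Ind_𝔹^{Γ_K} 1)/1`: there is a surjective
`K`-equivariant linear map from `Ind_𝔹^{Γ_K} 1` to it whose kernel is exactly the
constant functions. -/
def IsSteinberg {Wst : Type} [AddCommGroup Wst] [Module 𝔽 Wst]
    (σst : Representation 𝔽 ↥C.K Wst) : Prop :=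
  ∃ φ : ↥(PS1sub C 𝔽) →ₗ[𝔽] Wst, Function.Surjective φ ∧
    (∀ f : ↥(PS1sub C 𝔽), φ f = 0 ↔ ∃ c : 𝔽, (f : ↥C.K → 𝔽) = fun _ => c) ∧
    (∀ (k : ↥C.K) (f f' : ↥(PS1sub C 𝔽)),
      (f' : ↥C.K → 𝔽) = PSact C 𝔽 k (f : ↥C.K → 𝔽) → φ f' = σst k (φ f))

/-- `σ` is isomorphic to a twist of the Steinberg weight by a character. -/
def IsTwistSteinberg : Prop :=
  ∃ (c : ↥C.K →* 𝔽ˣ) (φ : ↥(PS1sub C 𝔽) →ₗ[𝔽] W), Function.Surjective φ ∧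
    (∀ f : ↥(PS1sub C 𝔽), φ f = 0 ↔ ∃ cc : 𝔽, (f : ↥C.K → 𝔽) = fun _ => cc) ∧
    (∀ (k : ↥C.K) (f f' : ↥(PS1sub C 𝔽)),
      (f' : ↥C.K → 𝔽) = PSact C 𝔽 k (f : ↥C.K → 𝔽) →
        φ f' = (c k : 𝔽) • σ k (φ f))


/-- The `K`-subrepresentation of the quotient `(ind_K^G σ) / (range T)` generated by the
image of a vector `v`. -/
def genQuot (T : Module.End 𝔽 ↥(IndSub C 𝔽 W σ)) (v : ↥(IndSub C 𝔽 W σ)) :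
    Submodule 𝔽 (↥(IndSub C 𝔽 W σ) ⧸ LinearMap.range T) :=
  Submodule.span 𝔽 {w | ∃ k ∈ C.K, w = Submodule.Quotient.mk (indRep C 𝔽 W σ k v)}

end Weight

/-- Smoothness of a representation of `G`: every vector is fixed by some congruence
subgroup (equivalently, has open stabilizer). -/
def SmoothRep {V : Type} [AddCommGroup V] [Module 𝔽 V] (ρ : Representation 𝔽 S.GG V) : Prop :=
  ∀ v : V, ∃ n : ℕ, ∀ g ∈ S.cong n, ρ g v = v

end RepTheory

end U21

namespace U21

section PGroupRep

/-- A finite `p`-group acting linearly on a nonzero vector space in characteristic `p` fixes a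
nonzero vector. -/
lemma exists_fixed_ne_zero {p : ℕ} (hp : p.Prime) {Q : Type} [Group Q] [Finite Q]
    (hQ : IsPGroup p Q) {𝔽 V : Type} [Field 𝔽] [AddCommGroup V] [Module 𝔽 V] (hchar : (p : 𝔽) = 0)
    (ρ : Representation 𝔽 Q V) {v : V} (hv : v ≠ 0) :
    ∃ w : V, w ≠ 0 ∧ ∀ g, ρ g w = w := by
  have hpv : ∀ x : V, p • x = 0 := fun x => by
    rw [← Nat.cast_smul_eq_nsmul 𝔽, hchar, zero_smul]
  obtain ⟨_⟩ : Nonempty (Module (ZMod p) V) := ⟨AddCommGroup.zmodModule hpv⟩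
  let A : Submodule (ZMod p) V := Submodule.span (ZMod p) (Set.range fun g => ρ g v)
  have : Fact p.Prime := ⟨hp⟩
  have : Module.Finite (ZMod p) ↥A :=
    Module.Finite.span_of_finite (ZMod p) (Set.finite_range fun g => ρ g v)
  have : Finite ↥A := Module.finite_of_finite (ZMod p)
  have hA : ∀ (g : Q) (x : V), x ∈ A → ρ g x ∈ A := by
    intro g x hx
    induction hx using Submodule.span_induction with
    | mem x hx =>
      obtain ⟨g', rfl⟩ := hx
      exact Submodule.subset_span ⟨g * g', by simp [map_mul]⟩
    | zero => simp
    | add x y _ _ hx hy => rw [map_add]; exact A.add_mem hx hy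
    | smul c x _ hx =>
      have : ρ g (c • x) = c • ρ g x := ((ρ g : V →+ V).toZModLinearMap p).map_smul c x
      rw [this]; exact A.smul_mem c hx
  let _ : MulAction Q ↥A :=
    { smul := fun g x => ⟨ρ g x, hA g x x.2⟩
      one_smul := fun x => Subtype.ext (by change ρ 1 (x : V) = x; simp)
      mul_smul := fun g h x => Subtype.ext (by
        change ρ (g * h) (x : V) = ρ g (ρ h x); simp [map_mul]) }
  have hvA : v ∈ A := Submodule.subset_span ⟨1, by simp⟩
  have hdvd : p ∣ Nat.card ↥A := by
    have h1 : addOrderOf (⟨v, hvA⟩ : A) = p :=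
      addOrderOf_eq_prime (Subtype.ext (by simpa using hpv v))
        (fun h => hv (congrArg Subtype.val h))
    exact (dvd_of_eq h1.symm).trans (addOrderOf_dvd_natCard _)
  obtain ⟨b, hb, hne⟩ := hQ.exists_fixed_point_of_prime_dvd_card_of_fixed_point A hdvd
    (a := (0 : A)) (fun g => Subtype.ext (by change ρ g (0 : V) = 0; simp))
  exact ⟨b, fun h => hne (Subtype.ext h.symm), fun g => congrArg Subtype.val (hb g)⟩

end PGroupRep

/-- The structure of a group with a `(B, N)`-pair of rank one in characteristic `p`, up to a
subgroup `N₁` of the unipotent part `N` acting trivially in the representations considered: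
`N` is the (preimage of the) unipotent radical, `H` the torus, and `β` a lift of the nontrivial
Weyl element. -/
structure RankOneDatum (p : ℕ) (Γ : Type) [Group Γ] where
  N : Subgroup Γ
  N₁ : Subgroup Γ
  H : Set Γ
  β : Γ
  conj_mem : ∀ u ∈ N, ∀ z ∈ N₁, u * z * u⁻¹ ∈ N₁
  fin : Finite (N ⧸ N₁.subgroupOf N)
  exists_not_mem : ∃ u ∈ N, u ∉ N₁
  pow_mem : ∀ u ∈ N, u ^ p ^ 2 ∈ N₁
  β_sq : β * β = 1
  H_inv : ∀ h ∈ H, h⁻¹ ∈ H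
  H_N : ∀ h ∈ H, ∀ u ∈ N, h * u * h⁻¹ ∈ N
  H_N₁ : ∀ h ∈ H, ∀ u ∈ N₁, h * u * h⁻¹ ∈ N₁
  β_H : ∀ h ∈ H, β * h * β ∈ H
  big_cell : ∀ u ∈ N, u ∉ N₁ → ∃ u' ∈ N, ∃ h ∈ H, ∃ n ∈ N, u * β = β * u' * β * h * n
  decomp : ∀ k, (∃ u ∈ N, ∃ h ∈ H, ∃ n ∈ N, k = β * u * β * h * n) ∨
    ∃ u ∈ N₁, ∃ h ∈ H, ∃ n ∈ N, k = u * β * h * n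

namespace RankOneDatum

variable {p : ℕ} {Γ : Type} [Group Γ] (D : RankOneDatum p Γ)
variable {𝔽 : Type} [Field 𝔽] {W : Type} [AddCommGroup W] [Module 𝔽 W]
variable (σ : Representation 𝔽 Γ W)

/-- The quotient `N / N₁`. -/
abbrev Quo : Type := D.N ⧸ D.N₁.subgroupOf D.N

instance : Finite D.Quo := D.fin

instance : Fintype D.Quo := Fintype.ofFinite _

instance normal_subgroupOf : (D.N₁.subgroupOf D.N).Normal :=
  ⟨fun z hz u => by
    simpa [Subgroup.mem_subgroupOf] using D.conj_mem u u.2 z (Subgroup.mem_subgroupOf.mp hz)⟩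

lemma β_inv : D.β⁻¹ = D.β := inv_eq_of_mul_eq_one_left D.β_sq

@[simp] lemma β_mul_β_mul (x : Γ) : D.β * (D.β * x) = x := by
  rw [← mul_assoc, D.β_sq, one_mul]

/-- A chosen representative in `N` of a class in `N / N₁`. -/
def rep (c : D.Quo) : Γ := (Quotient.out c : D.N)

lemma rep_mem (c : D.Quo) : D.rep c ∈ D.N := (Quotient.out c : D.N).2

lemma mk_rep (c : D.Quo) : (QuotientGroup.mk ⟨D.rep c, D.rep_mem c⟩ : D.Quo) = c :=
  Quotient.out_eq c

lemma isPGroup_quo : IsPGroup p D.Quo := by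
  intro c
  refine ⟨2, ?_⟩
  rw [← D.mk_rep c, ← QuotientGroup.mk_pow, QuotientGroup.eq_one_iff, Subgroup.mem_subgroupOf]
  simpa using D.pow_mem _ (D.rep_mem c)

lemma rep_not_mem {c : D.Quo} (hc : c ≠ 1) : D.rep c ∉ D.N₁ := by
  intro h
  apply hc
  rw [← D.mk_rep c, QuotientGroup.eq_one_iff, Subgroup.mem_subgroupOf]
  exact h

lemma rep_one_mem : D.rep 1 ∈ D.N₁ := by
  have h := D.mk_rep 1
  rwa [QuotientGroup.eq_one_iff, Subgroup.mem_subgroupOf] at h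

lemma natCast_card_quo (hp : p.Prime) (hchar : (p : 𝔽) = 0) : (Fintype.card D.Quo : 𝔽) = 0 := by
  have : Fact p.Prime := ⟨hp⟩
  obtain ⟨n, hn⟩ := IsPGroup.iff_card.mp D.isPGroup_quo
  have hn0 : n ≠ 0 := by
    rintro rfl
    obtain ⟨u, hu, hu1⟩ := D.exists_not_mem
    have : Subsingleton D.Quo := (Nat.card_eq_one_iff_unique.mp (by simpa using hn)).1
    have h1 : (QuotientGroup.mk ⟨u, hu⟩ : D.Quo) = 1 := Subsingleton.elim _ _
    rw [QuotientGroup.eq_one_iff, Subgroup.mem_subgroupOf] at h1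
    exact hu1 h1
  rw [← Nat.card_eq_fintype_card, hn, Nat.cast_pow, hchar, zero_pow hn0]

/-- `σ` is trivial on `N₁`. -/
def TrivOn : Prop := ∀ u ∈ D.N₁, σ u = 1

variable {σ}

/-- The representation of `N / N₁` induced by `σ`. -/
def quoRep (h1 : D.TrivOn σ) : Representation 𝔽 D.Quo W :=
  QuotientGroup.lift _ (σ.comp D.N.subtype) fun u hu => h1 u (Subgroup.mem_subgroupOf.mp hu)

lemma quoRep_mk (h1 : D.TrivOn σ) (u : D.N) : D.quoRep h1 (QuotientGroup.mk u) = σ u := rfl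

lemma quoRep_eq (h1 : D.TrivOn σ) (c : D.Quo) : D.quoRep h1 c = σ (D.rep c) := by
  conv_lhs => rw [← D.mk_rep c]
  rfl

variable (σ)

/-- The sum of the operators `σ u` over representatives `u` of `N / N₁`. -/
def avg : Module.End 𝔽 W := ∑ c : D.Quo, σ (D.rep c)

/-- The operator `∑ u ∈ N / N₁, σ (u β)`. -/
def T : Module.End 𝔽 W := D.avg σ * σ D.β

variable {σ}

lemma avg_eq (h1 : D.TrivOn σ) : D.avg σ = ∑ c : D.Quo, D.quoRep h1 c :=
  Finset.sum_congr rfl fun c _ => (D.quoRep_eq h1 c).symm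

lemma avg_mul (h1 : D.TrivOn σ) {u : Γ} (hu : u ∈ D.N) : D.avg σ * σ u = D.avg σ := by
  rw [D.avg_eq h1, ← D.quoRep_mk h1 ⟨u, hu⟩, Finset.sum_mul]
  simp_rw [← map_mul]
  exact Fintype.sum_equiv (Equiv.mulRight (QuotientGroup.mk ⟨u, hu⟩ : D.Quo)) _ _ fun _ => rfl

lemma mul_avg (h1 : D.TrivOn σ) {u : Γ} (hu : u ∈ D.N) : σ u * D.avg σ = D.avg σ := by
  rw [D.avg_eq h1, ← D.quoRep_mk h1 ⟨u, hu⟩, Finset.mul_sum]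
  simp_rw [← map_mul]
  exact Fintype.sum_equiv (Equiv.mulLeft (QuotientGroup.mk ⟨u, hu⟩ : D.Quo)) _ _ fun _ => rfl

lemma H_mul_avg (h1 : D.TrivOn σ) {h : Γ} (hh : h ∈ D.H) : σ h * D.avg σ = D.avg σ * σ h := by
  let e : D.Quo → D.Quo := fun c => QuotientGroup.mk ⟨h * D.rep c * h⁻¹, D.H_N h hh _ (D.rep_mem c)⟩
  have he : Function.Injective e := by
    intro a b hab
    rw [QuotientGroup.eq, Subgroup.mem_subgroupOf] at hab
    have h2 := D.H_N₁ _ (D.H_inv h hh) _ hab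
    rw [← D.mk_rep a, ← D.mk_rep b, QuotientGroup.eq, Subgroup.mem_subgroupOf]
    convert h2 using 1
    simp [mul_assoc]
  have hb : Function.Bijective e := Finite.injective_iff_bijective.mp he
  conv_rhs => rw [D.avg_eq h1, ← hb.sum_comp, Finset.sum_mul]
  rw [avg, Finset.mul_sum]
  refine Finset.sum_congr rfl fun c _ => ?_
  rw [D.quoRep_mk h1, ← map_mul, ← map_mul]
  simp

variable (σ)

/-- `x` is fixed by `N` and is an eigenvector of `H` with eigencharacter `χ`. -/
def IsEigen (χ : Γ → 𝔽) (x : W) : Prop :=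
  (∀ u ∈ D.N, σ u x = x) ∧ ∀ h ∈ D.H, σ h x = χ h • x

/-- `ℓ` is fixed by the opposite unipotent group `β N β`. -/
def IsInv (ℓ : W →ₗ[𝔽] 𝔽) : Prop := ∀ u ∈ D.N, ∀ x, ℓ (σ (D.β * u * D.β) x) = ℓ x

variable {σ}

lemma T_apply (x : W) : D.T σ x = ∑ c : D.Quo, σ (D.rep c * D.β) x := by
  simp [T, avg, LinearMap.sum_apply, map_mul]

lemma T_eigen (h1 : D.TrivOn σ) {χ : Γ → 𝔽} {x : W} (hx : D.IsEigen σ χ x) :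
    D.IsEigen σ (fun h => χ (D.β * h * D.β)) (D.T σ x) := by
  constructor
  · intro u hu
    rw [T, ← Module.End.mul_apply, ← mul_assoc, D.mul_avg h1 hu]
  · intro h hh
    rw [T, ← Module.End.mul_apply, ← mul_assoc, D.H_mul_avg h1 hh, mul_assoc,
      Module.End.mul_apply, ← map_mul,
      show h * D.β = D.β * (D.β * h * D.β) by simp [mul_assoc], map_mul, Module.End.mul_apply,
      hx.2 _ (D.β_H h hh), map_smul, map_smul, Module.End.mul_apply]

lemma span_eq_top (h1 : D.TrivOn σ)
    (hirr : ∀ A : Submodule 𝔽 W, (∀ (k : Γ) (w : W), w ∈ A → σ k w ∈ A) → A = ⊥ ∨ A = ⊤)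
    {χ : Γ → 𝔽} {x : W} (hx : D.IsEigen σ χ x) (hx0 : x ≠ 0) (hT : D.T σ x = 0) :
    Submodule.span 𝔽 {y | ∃ u ∈ D.N, y = σ (D.β * u * D.β) x} = ⊤ := by
  set A := Submodule.span 𝔽 {y | ∃ u ∈ D.N, y = σ (D.β * u * D.β) x} with hA
  have hsub : ∀ u ∈ D.N, ∀ h ∈ D.H, ∀ n ∈ D.N, σ (D.β * u * D.β * h * n) x ∈ A := by
    intro u hu h hh n hn
    rw [map_mul, Module.End.mul_apply, hx.1 n hn, map_mul, Module.End.mul_apply, hx.2 h hh,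
      map_smul]
    exact A.smul_mem _ (Submodule.subset_span ⟨u, hu, rfl⟩)
  have hβ : σ D.β x ∈ A := by
    have h2 := hT
    rw [T_apply, ← Finset.add_sum_erase _ _ (Finset.mem_univ (1 : D.Quo)), map_mul,
      h1 _ D.rep_one_mem, one_mul] at h2
    rw [eq_neg_of_add_eq_zero_left h2]
    refine A.neg_mem (A.sum_mem fun c hc => ?_)
    obtain ⟨u, hu, h, hh, n, hn, he⟩ :=
      D.big_cell _ (D.rep_mem c) (D.rep_not_mem (Finset.ne_of_mem_erase hc))
    rw [he]
    exact hsub u hu h hh n hn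
  have hK : ∀ k, σ k x ∈ A := by
    intro k
    rcases D.decomp k with ⟨u, hu, h, hh, n, hn, rfl⟩ | ⟨u, hu, h, hh, n, hn, rfl⟩
    · exact hsub u hu h hh n hn
    · rw [map_mul, Module.End.mul_apply, hx.1 n hn, map_mul, Module.End.mul_apply, hx.2 h hh,
        map_smul, map_mul, h1 u hu, one_mul]
      exact A.smul_mem _ hβ
  let B := Submodule.span 𝔽 (Set.range fun k => σ k x)
  have hB : B ≤ A := Submodule.span_le.mpr (by rintro _ ⟨k, rfl⟩; exact hK k)
  have hBinv : ∀ (k : Γ) (w : W), w ∈ B → σ k w ∈ B := by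
    intro k w hw
    have : B.map (σ k) ≤ B := by
      rw [Submodule.map_span_le]
      rintro _ ⟨k', rfl⟩
      exact Submodule.subset_span ⟨k * k', by simp [map_mul]⟩
    exact this (Submodule.mem_map_of_mem hw)
  rcases hirr B hBinv with h | h
  · have : x ∈ B := Submodule.subset_span ⟨1, by simp⟩
    rw [h, Submodule.mem_bot] at this
    exact absurd this hx0
  · exact top_le_iff.mp (h ▸ hB)

lemma inv_apply_eq_zero (h1 : D.TrivOn σ)
    (hirr : ∀ A : Submodule 𝔽 W, (∀ (k : Γ) (w : W), w ∈ A → σ k w ∈ A) → A = ⊥ ∨ A = ⊤)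
    {χ ψ : Γ → 𝔽} {x y : W} (hx : D.IsEigen σ χ x) (hx0 : x ≠ 0) (hT : D.T σ x = 0)
    (hy : D.IsEigen σ ψ y) (hne : ∃ h ∈ D.H, χ h ≠ ψ h) {ℓ : W →ₗ[𝔽] 𝔽} (hℓ : D.IsInv σ ℓ) :
    ℓ y = 0 := by
  obtain ⟨h, hh, hne⟩ := hne
  have key : ∀ z : W, ℓ (σ h z) = χ h * ℓ z := by
    intro z
    have hz : z ∈ Submodule.span 𝔽 {y | ∃ u ∈ D.N, y = σ (D.β * u * D.β) x} := by
      rw [D.span_eq_top h1 hirr hx hx0 hT]; trivial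
    induction hz using Submodule.span_induction with
    | mem z hz =>
      obtain ⟨u, hu, rfl⟩ := hz
      have hu' := D.H_N _ (D.β_H h hh) u hu
      rw [hℓ u hu, ← Module.End.mul_apply, ← map_mul,
        show h * (D.β * u * D.β) =
          D.β * ((D.β * h * D.β) * u * (D.β * h * D.β)⁻¹) * D.β * h by
            simp [mul_assoc, D.β_inv],
        map_mul, Module.End.mul_apply, hℓ _ hu', hx.2 h hh, map_smul, smul_eq_mul]
    | zero => simp
    | add a b _ _ ha hb => simp only [map_add, ha, hb, mul_add]
    | smul c a _ ha => simp only [map_smul, ha, smul_eq_mul]; ring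
  have h2 := key y
  rw [hy.2 h hh, map_smul, smul_eq_mul] at h2
  by_contra h0
  exact hne (mul_right_cancel₀ h0 h2).symm

lemma T_mul (h1 : D.TrivOn σ) {u : Γ} (hu : u ∈ D.N) (x : W) :
    D.T σ (σ (D.β * u * D.β) x) = D.T σ x := by
  rw [← Module.End.mul_apply, T, mul_assoc, ← map_mul,
    show D.β * (D.β * u * D.β) = u * D.β by simp [mul_assoc], map_mul, ← mul_assoc,
    D.avg_mul h1 hu]

lemma isInv_comp_T (h1 : D.TrivOn σ) (ℓ : W →ₗ[𝔽] 𝔽) : D.IsInv σ (ℓ ∘ₗ D.T σ) := by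
  intro u hu x
  rw [LinearMap.comp_apply, D.T_mul h1 hu, LinearMap.comp_apply]

lemma exists_isInv_ne_zero (hp : p.Prime) (hchar : (p : 𝔽) = 0) (h1 : D.TrivOn σ) [Nontrivial W] :
    ∃ ℓ : W →ₗ[𝔽] 𝔽, ℓ ≠ 0 ∧ D.IsInv σ ℓ := by
  obtain ⟨w, hw⟩ := exists_ne (0 : W)
  obtain ⟨m, hm⟩ : ∃ m : Module.Dual 𝔽 W, m ≠ 0 := by
    by_contra! h
    exact hw ((Module.forall_dual_apply_eq_zero_iff 𝔽 w).mp fun f => by simp [h f])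
  obtain ⟨ℓ, hℓ, hfix⟩ := exists_fixed_ne_zero hp D.isPGroup_quo hchar (D.quoRep h1).dual hm
  refine ⟨ℓ ∘ₗ σ D.β, fun h => hℓ (LinearMap.ext fun x => ?_), fun u hu x => ?_⟩
  · have h2 := LinearMap.congr_fun h (σ D.β x)
    rw [LinearMap.comp_apply, ← Module.End.mul_apply, ← map_mul, D.β_sq, map_one] at h2
    simpa using h2
  · have h2 := LinearMap.congr_fun
      (hfix (QuotientGroup.mk ⟨u⁻¹, D.N.inv_mem hu⟩)) (σ D.β x)
    rw [Representation.dual_apply, Module.Dual.transpose_apply, LinearMap.comp_apply,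
      ← QuotientGroup.mk_inv, D.quoRep_mk h1] at h2
    simp only [InvMemClass.coe_inv, inv_inv] at h2
    rw [LinearMap.comp_apply, LinearMap.comp_apply, ← h2, ← Module.End.mul_apply, ← map_mul,
      ← Module.End.mul_apply, ← map_mul]
    simp [mul_assoc]

/-- On vectors whose eigencharacter is regular, the operator `T` vanishes. -/
lemma T_eq_zero (hp : p.Prime) (hchar : (p : 𝔽) = 0) (h1 : D.TrivOn σ)
    (hirr : ∀ A : Submodule 𝔽 W, (∀ (k : Γ) (w : W), w ∈ A → σ k w ∈ A) → A = ⊥ ∨ A = ⊤)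
    {χ : Γ → 𝔽} (hreg : ∃ h ∈ D.H, χ h ≠ χ (D.β * h * D.β)) {x : W} (hx : D.IsEigen σ χ x) :
    D.T σ x = 0 := by
  by_contra hTx
  have hx' := D.T_eigen h1 hx
  have hTT : D.T σ (D.T σ x) = 0 := by
    have hterm : ∀ c : D.Quo, c ≠ 1 → ∃ a : 𝔽,
        D.T σ (σ (D.rep c * D.β) x) = a • D.T σ x := by
      intro c hc
      obtain ⟨u, hu, h, hh, n, hn, he⟩ := D.big_cell _ (D.rep_mem c) (D.rep_not_mem hc)
      refine ⟨χ h, ?_⟩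
      rw [he, map_mul, Module.End.mul_apply, hx.1 n hn, map_mul, Module.End.mul_apply, hx.2 h hh,
        map_smul, map_smul, D.T_mul h1 hu]
    have hone : D.T σ (σ (D.rep 1 * D.β) x) = 0 := by
      rw [map_mul, h1 _ D.rep_one_mem, one_mul, T, Module.End.mul_apply, ← Module.End.mul_apply (σ D.β), ← map_mul,
        D.β_sq, map_one, Module.End.one_apply, avg, LinearMap.sum_apply,
        Finset.sum_congr rfl fun c _ => hx.1 _ (D.rep_mem c), Finset.sum_const,
        Finset.card_univ, ← Nat.cast_smul_eq_nsmul 𝔽, D.natCast_card_quo hp hchar, zero_smul]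
    have hex : ∃ a : 𝔽, D.T σ (D.T σ x) = a • D.T σ x := by
      have hf : ∀ c : D.Quo, ∃ a : 𝔽,
          D.T σ (σ (D.rep c * D.β) x) = a • D.T σ x := by
        intro c
        by_cases hc : c = 1
        · exact ⟨0, by rw [hc, hone, zero_smul]⟩
        · exact hterm c hc
      choose a ha using hf
      refine ⟨∑ c, a c, ?_⟩
      conv_lhs => rw [D.T_apply x, map_sum]
      rw [Finset.sum_smul]
      exact Finset.sum_congr rfl fun c _ => ha c
    obtain ⟨a, ha⟩ := hex
    obtain ⟨h, hh, hne⟩ := hreg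
    have e1 := (D.T_eigen h1 hx').2 h hh
    rw [ha, map_smul, hx'.2 h hh] at e1
    simp only [mul_assoc, D.β_sq, β_mul_β_mul, mul_one] at e1
    rw [ha]
    by_contra h0
    rw [smul_comm] at e1
    refine hne (smul_left_injective 𝔽 h0 ?_).symm
    simpa [mul_assoc] using e1
  refine hTx ((Module.forall_dual_apply_eq_zero_iff 𝔽 _).mp fun ℓ => ?_)
  obtain ⟨h, hh, hne⟩ := hreg
  exact D.inv_apply_eq_zero h1 hirr hx' hTx hTT hx ⟨h, hh, fun h' => hne h'.symm⟩
    (D.isInv_comp_T h1 ℓ)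

/-- The `N`-invariants of an irreducible representation cannot afford both a regular character
and its Weyl conjugate. -/
lemma eigen_swap_eq_zero (hp : p.Prime) (hchar : (p : 𝔽) = 0) (h1 : D.TrivOn σ)
    (hirr : ∀ A : Submodule 𝔽 W, (∀ (k : Γ) (w : W), w ∈ A → σ k w ∈ A) → A = ⊥ ∨ A = ⊤)
    {χ : Γ → 𝔽} (hreg : ∃ h ∈ D.H, χ h ≠ χ (D.β * h * D.β)) {x y : W} (hx : D.IsEigen σ χ x)
    (hx0 : x ≠ 0) (hy : D.IsEigen σ (fun h => χ (D.β * h * D.β)) y) : y = 0 := by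
  by_contra hy0
  have hTx := D.T_eq_zero hp hchar h1 hirr hreg hx
  have hTy : D.T σ y = 0 := by
    refine D.T_eq_zero hp hchar h1 hirr ?_ hy
    obtain ⟨h, hh, hne⟩ := hreg
    refine ⟨h, hh, fun h' => hne ?_⟩
    simpa [mul_assoc, D.β_sq] using h'.symm
  have : Nontrivial W := ⟨⟨x, 0, hx0⟩⟩
  obtain ⟨ℓ, hℓ0, hℓ⟩ := D.exists_isInv_ne_zero hp hchar h1
  refine hℓ0 (LinearMap.ext fun z => ?_)
  have hz : z ∈ Submodule.span 𝔽 {w | ∃ u ∈ D.N, w = σ (D.β * u * D.β) y} := by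
    rw [D.span_eq_top h1 hirr hy hy0 hTy]; trivial
  have hyz : ℓ y = 0 := D.inv_apply_eq_zero h1 hirr hx hx0 hTx hy hreg hℓ
  induction hz using Submodule.span_induction with
  | mem z hz =>
    obtain ⟨u, hu, rfl⟩ := hz
    rw [hℓ u hu, hyz, LinearMap.zero_apply]
  | zero => simp
  | add a b _ _ ha hb => rw [map_add, ha, hb, map_add]
  | smul c a _ ha => rw [map_smul, ha, map_smul]

end RankOneDatum

namespace Setting

variable (S : Setting)

section Valuation

lemma not_inv_unif_mem : S.ϖ⁻¹ ∉ S.O := fun h =>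
  S.unif_not_unit (IsUnit.of_mul_eq_one ⟨S.ϖ⁻¹, h⟩ (Subtype.ext (mul_inv_cancel₀ S.unif_ne)))

lemma unit_ne_zero (u : S.Oˣ) : ((u : S.O) : S.E) ≠ 0 := fun h =>
  u.ne_zero (Subtype.ext h)

lemma unit_inv_coe (u : S.Oˣ) : (((u⁻¹ : S.Oˣ) : S.O) : S.E) = ((u : S.O) : S.E)⁻¹ := by
  exact eq_inv_of_mul_eq_one_left (congrArg (fun z : S.O => (z : S.E)) u.inv_mul)

lemma unif_zpow_mem {n : ℤ} : S.ϖ ^ n ∈ S.O ↔ 0 ≤ n := by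
  constructor
  · intro h
    by_contra hn
    push Not at hn
    obtain ⟨m, rfl⟩ : ∃ m : ℕ, n = -(m : ℤ) - 1 := ⟨(-n - 1).toNat, by omega⟩
    apply S.not_inv_unif_mem
    have := S.O.mul_mem (S.O.pow_mem S.unif_mem m) h
    rwa [← zpow_natCast, ← zpow_add₀ S.unif_ne, show (m : ℤ) + (-m - 1) = -1 by ring,
      zpow_neg_one] at this
  · intro h
    obtain ⟨m, rfl⟩ := Int.eq_ofNat_of_zero_le h
    rw [zpow_natCast]
    exact S.O.pow_mem S.unif_mem m

/-- The valuation of a nonzero element of `E` (with junk value at `0`). -/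
def ord (x : S.E) : ℤ := if h : x = 0 then 0 else (S.disc x h).choose

lemma exists_unit_ord {x : S.E} (hx : x ≠ 0) : ∃ u : S.Oˣ, x = (u : S.O) * S.ϖ ^ S.ord x := by
  rw [ord, dif_neg hx]
  exact (S.disc x hx).choose_spec

lemma mem_pE_iff {k : ℤ} {x : S.E} : x ∈ S.pE k ↔ S.ϖ ^ (-k) * x ∈ S.O := by
  constructor
  · rintro ⟨w, hw, rfl⟩
    rwa [← mul_assoc, ← zpow_add₀ S.unif_ne, neg_add_cancel, zpow_zero, one_mul]
  · intro h
    exact ⟨_, h, by rw [← mul_assoc, ← zpow_add₀ S.unif_ne, add_neg_cancel, zpow_zero, one_mul]⟩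

lemma unit_mul_zpow_mem_pE {u : S.Oˣ} {n k : ℤ} :
    ((u : S.O) : S.E) * S.ϖ ^ n ∈ S.pE k ↔ k ≤ n := by
  rw [mem_pE_iff, mul_left_comm, ← zpow_add₀ S.unif_ne, ← sub_nonneg, ← S.unif_zpow_mem,
    neg_add_eq_sub]
  constructor
  · intro h
    have := S.O.mul_mem (u⁻¹ : S.Oˣ).1.2 h
    rwa [S.unit_inv_coe, inv_mul_cancel_left₀ (S.unit_ne_zero u)] at this
  · exact fun h => S.O.mul_mem u.1.2 h

lemma mem_pE_iff_le_ord {k : ℤ} {x : S.E} (hx : x ≠ 0) : x ∈ S.pE k ↔ k ≤ S.ord x := by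
  obtain ⟨u, hu⟩ := S.exists_unit_ord hx
  conv_lhs => rw [hu]
  exact S.unit_mul_zpow_mem_pE

lemma ord_eq_of_forall {x : S.E} (hx : x ≠ 0) {n : ℤ} (h : ∀ k, x ∈ S.pE k ↔ k ≤ n) :
    S.ord x = n :=
  le_antisymm ((h _).mp ((S.mem_pE_iff_le_ord hx).mpr le_rfl))
    ((S.mem_pE_iff_le_ord hx).mp ((h n).mpr le_rfl))

lemma ord_unit_mul_zpow (u : S.Oˣ) (n : ℤ) : S.ord (((u : S.O) : S.E) * S.ϖ ^ n) = n :=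
  S.ord_eq_of_forall (mul_ne_zero (S.unit_ne_zero u) (zpow_ne_zero _ S.unif_ne))
    fun _ => S.unit_mul_zpow_mem_pE

lemma ord_mul {x y : S.E} (hx : x ≠ 0) (hy : y ≠ 0) : S.ord (x * y) = S.ord x + S.ord y := by
  obtain ⟨u, hu⟩ := S.exists_unit_ord hx
  obtain ⟨v, hv⟩ := S.exists_unit_ord hy
  rw [← S.ord_unit_mul_zpow (u * v) (S.ord x + S.ord y), zpow_add₀ S.unif_ne]
  conv_lhs => rw [hu, hv]
  congr 1
  push_cast
  ring

@[simp] lemma ord_one : S.ord 1 = 0 := by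
  have h := S.ord_mul one_ne_zero (one_ne_zero (α := S.E))
  rw [mul_one] at h
  omega

lemma ord_inv {x : S.E} (hx : x ≠ 0) : S.ord x⁻¹ = -S.ord x := by
  have h := S.ord_mul hx (inv_ne_zero hx)
  rw [mul_inv_cancel₀ hx, ord_one] at h
  omega

lemma ord_zpow (n : ℤ) : S.ord (S.ϖ ^ n) = n := by
  simpa using S.ord_unit_mul_zpow 1 n

lemma conj_unif_zpow (n : ℤ) : S.conj (S.ϖ ^ n) = S.ϖ ^ n := by
  rw [map_zpow₀, S.unif_conj]

lemma conj_mem_pE {k : ℤ} {x : S.E} (hx : x ∈ S.pE k) : S.conj x ∈ S.pE k := by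
  obtain ⟨w, hw, rfl⟩ := hx
  exact ⟨S.conj w, S.conj_O w hw, by rw [map_mul, conj_unif_zpow]⟩

lemma conj_mem_pE_iff {k : ℤ} {x : S.E} : S.conj x ∈ S.pE k ↔ x ∈ S.pE k :=
  ⟨fun h => by simpa [S.conj_invol] using S.conj_mem_pE h, S.conj_mem_pE⟩

lemma conj_ne_zero {x : S.E} (hx : x ≠ 0) : S.conj x ≠ 0 :=
  (map_ne_zero S.conj).mpr hx

lemma ord_conj {x : S.E} (hx : x ≠ 0) : S.ord (S.conj x) = S.ord x :=
  S.ord_eq_of_forall (S.conj_ne_zero hx) fun _ => by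
    rw [S.conj_mem_pE_iff, S.mem_pE_iff_le_ord hx]

lemma mem_pE_zero {x : S.E} : x ∈ S.pE 0 ↔ x ∈ S.O := by
  simp [mem_pE_iff]

lemma zero_mem_pE (k : ℤ) : (0 : S.E) ∈ S.pE k := ⟨0, S.O.zero_mem, by simp⟩

lemma add_mem_pE {k : ℤ} {x y : S.E} (hx : x ∈ S.pE k) (hy : y ∈ S.pE k) : x + y ∈ S.pE k := by
  rw [mem_pE_iff] at *
  rw [mul_add]
  exact S.O.add_mem hx hy

lemma neg_mem_pE {k : ℤ} {x : S.E} (hx : x ∈ S.pE k) : -x ∈ S.pE k := by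
  rw [mem_pE_iff] at *
  rw [mul_neg]
  exact S.O.neg_mem hx

lemma sub_mem_pE {k : ℤ} {x y : S.E} (hx : x ∈ S.pE k) (hy : y ∈ S.pE k) : x - y ∈ S.pE k := by
  rw [sub_eq_add_neg]
  exact S.add_mem_pE hx (S.neg_mem_pE hy)

lemma mul_mem_pE {i j k : ℤ} {x y : S.E} (hx : x ∈ S.pE i) (hy : y ∈ S.pE j) (h : i + j = k) :
    x * y ∈ S.pE k := by
  obtain ⟨a, ha, rfl⟩ := hx
  obtain ⟨b, hb, rfl⟩ := hy
  exact ⟨a * b, S.O.mul_mem ha hb, by rw [← h, zpow_add₀ S.unif_ne]; ring⟩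

lemma pE_mono {i j : ℤ} (h : i ≤ j) {x : S.E} (hx : x ∈ S.pE j) : x ∈ S.pE i := by
  by_cases h0 : x = 0
  · exact h0 ▸ S.zero_mem_pE i
  · rw [S.mem_pE_iff_le_ord h0] at *
    exact h.trans hx

lemma inv_mem_pE {k : ℤ} {x : S.E} (hx : x ∉ S.pE k) : x⁻¹ ∈ S.pE (1 - k) := by
  have h0 : x ≠ 0 := fun h => hx (h ▸ S.zero_mem_pE k)
  rw [S.mem_pE_iff_le_ord (inv_ne_zero h0), S.ord_inv h0]
  rw [S.mem_pE_iff_le_ord h0] at hx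
  omega

lemma zpow_mem_pE {k n : ℤ} (h : k ≤ n) : S.ϖ ^ n ∈ S.pE k := by
  rw [S.mem_pE_iff_le_ord (zpow_ne_zero _ S.unif_ne), ord_zpow]
  exact h

lemma intCast_mem_pE (n : ℤ) : (n : S.E) ∈ S.pE 0 := by
  rw [mem_pE_zero]
  exact intCast_mem S.O n

lemma natCast_p_mem_pE : (S.p : S.E) ∈ S.pE 1 := by
  have hp0 : 0 < S.p := S.hp.pos
  by_contra h
  have hinv : ((S.p : S.E))⁻¹ ∈ S.pE 0 := by simpa using S.inv_mem_pE h
  have hcard : ((S.q ^ 2 : ℕ) : S.O) ∈ S.mI := by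
    rw [← Ideal.Quotient.eq_zero_iff_mem, map_natCast, ← S.card_res, Nat.cast_card_eq_zero]
  rw [S.hmI] at hcard
  obtain ⟨y, hy, he⟩ := hcard
  rw [S.hq, ← pow_mul] at he
  push_cast at he
  have hpow : ((S.p : S.E) ^ (S.fdeg * 2))⁻¹ ∈ S.O := by
    rw [← inv_pow]
    exact S.O.pow_mem (S.mem_pE_zero.mp hinv) _
  have hp1 : (S.p : S.E) ≠ 0 := fun h0 => h (h0 ▸ S.zero_mem_pE 1)
  apply S.not_inv_unif_mem
  have h1 : S.ϖ⁻¹ = y * ((S.p : S.E) ^ (S.fdeg * 2))⁻¹ := by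
    rw [he]
    field_simp
    have hy0 : y ≠ 0 := by
      rintro rfl
      exact pow_ne_zero (S.fdeg * 2) hp1 (by rw [he, mul_zero])
    field_simp [hy0, S.unif_ne]
  rw [h1]
  exact S.O.mul_mem hy hpow

/-- There is a trace-zero element of any prescribed valuation. -/
lemma exists_trace_zero (k : ℤ) : ∃ t : S.E, t ≠ 0 ∧ S.ord t = k ∧ t + S.conj t = 0 := by
  obtain ⟨z, hz⟩ : ∃ z, S.conj z ≠ z := by
    by_contra! h
    exact S.conj_ne (RingHom.ext h)
  have h0 : z - S.conj z ≠ 0 := sub_ne_zero.mpr hz.symm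
  refine ⟨(z - S.conj z) * S.ϖ ^ (k - S.ord (z - S.conj z)),
    mul_ne_zero h0 (zpow_ne_zero _ S.unif_ne), ?_, ?_⟩
  · rw [S.ord_mul h0 (zpow_ne_zero _ S.unif_ne), ord_zpow]
    ring
  · rw [map_mul, conj_unif_zpow, map_sub, S.conj_invol]
    ring

/-- The bound on `x` forced by the bound on `y` in the equation defining `N`. -/
lemma mem_pE_of_norm_eq {x y : S.E} (h : x * S.conj x + y + S.conj y = 0) {j k : ℤ}
    (hy : y ∈ S.pE k) (hjk : 2 * j ≤ k + 1) : x ∈ S.pE j := by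
  by_cases hx : x = 0
  · exact hx ▸ S.zero_mem_pE j
  have h1 : x * S.conj x ∈ S.pE k := by
    rw [show x * S.conj x = -(y + S.conj y) by linear_combination h]
    exact S.neg_mem_pE (S.add_mem_pE hy (S.conj_mem_pE hy))
  rw [S.mem_pE_iff_le_ord (mul_ne_zero hx (S.conj_ne_zero hx)),
    S.ord_mul hx (S.conj_ne_zero hx), S.ord_conj hx] at h1
  rw [S.mem_pE_iff_le_ord hx]
  omega

end Valuation

end Setting

namespace Setting

variable (S : Setting)

section Matrices

@[simp] lemma unif_zpow_mul_inv (n : ℤ) : S.ϖ ^ n * (S.ϖ ^ n)⁻¹ = 1 :=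
  mul_inv_cancel₀ (zpow_ne_zero _ S.unif_ne)

@[simp] lemma inv_mul_unif_zpow (n : ℤ) : (S.ϖ ^ n)⁻¹ * S.ϖ ^ n = 1 :=
  inv_mul_cancel₀ (zpow_ne_zero _ S.unif_ne)

lemma mat_injective : Function.Injective S.mat := fun _ _ h => Subtype.ext (Units.ext h)

@[simp] lemma mat_mul (g h : S.GG) : S.mat (g * h) = S.mat g * S.mat h := rfl

@[simp] lemma mat_one : S.mat 1 = 1 := rfl

/-- The unitarity relation between two columns of an element of `G`. -/
lemma col_rel (g : S.GG) (i j : Fin 3) :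
    S.mat g 0 i * S.conj (S.mat g 2 j) + S.mat g 1 i * S.conj (S.mat g 1 j) +
      S.mat g 2 i * S.conj (S.mat g 0 j) = S.betaM i j := by
  have h : (S.mat g).transpose * S.betaM * (S.mat g).map S.conj = S.betaM := g.2
  rw [← h]
  simp [Matrix.mul_apply, Fin.sum_univ_three, betaM]
  ring

lemma mat_inv (g : S.GG) :
    S.mat g⁻¹ = S.betaM * ((S.mat g).map S.conj).transpose * S.betaM := by
  have h : (S.mat g).transpose * S.betaM * (S.mat g).map S.conj = S.betaM := g.2
  have hβ : S.betaM.map S.conj = S.betaM := by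
    ext i j
    fin_cases i <;> fin_cases j <;> simp [betaM]
  have h2 := congrArg (fun M : S.M3 => M.map S.conj) h
  simp only [Matrix.map_mul, Matrix.map_map, hβ] at h2
  have h3 : (S.mat g).map (S.conj ∘ S.conj) = S.mat g := by
    ext i j
    simp [S.conj_invol]
  rw [h3] at h2
  have h4 : S.betaM * ((S.mat g).map S.conj).transpose * S.betaM * S.mat g = 1 := by
    rw [mul_assoc, mul_assoc, ← mul_assoc _ S.betaM]
    exact (congrArg _ h2).trans S.beta_mul_beta
  have h5 : S.mat g * S.mat g⁻¹ = 1 := by rw [← mat_mul, mul_inv_cancel, mat_one]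
  calc S.mat g⁻¹ = S.betaM * ((S.mat g).map S.conj).transpose * S.betaM * S.mat g * S.mat g⁻¹ := by
        rw [h4, one_mul]
    _ = _ := by rw [mul_assoc _ (S.mat g), h5, mul_one]

lemma mat_inv_fin (g : S.GG) : S.mat g⁻¹ =
    !![S.conj (S.mat g 2 2), S.conj (S.mat g 1 2), S.conj (S.mat g 0 2);
       S.conj (S.mat g 2 1), S.conj (S.mat g 1 1), S.conj (S.mat g 0 1);
       S.conj (S.mat g 2 0), S.conj (S.mat g 1 0), S.conj (S.mat g 0 0)] := by
  rw [mat_inv]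
  ext i j
  fin_cases i <;> fin_cases j <;> simp [betaM, Matrix.mul_apply, Fin.sum_univ_three, Matrix.vecMul, dotProduct]

/-- The element of `G` with a given unitary matrix. -/
def mkG (M : S.M3) (h : M.transpose * S.betaM * M.map S.conj = S.betaM) : S.GG :=
  ⟨Matrix.GeneralLinearGroup.mkOfDetNeZero M fun h0 => by
    have h1 := congrArg Matrix.det h
    rw [Matrix.det_mul, Matrix.det_mul, Matrix.det_transpose, h0, zero_mul, zero_mul] at h1
    have h2 := congrArg Matrix.det S.beta_mul_beta
    rw [Matrix.det_mul, ← h1, zero_mul, Matrix.det_one] at h2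
    exact zero_ne_one h2, h⟩

@[simp] lemma mat_mkG (M : S.M3) (h) : S.mat (S.mkG M h) = M := rfl

lemma eq_fin_three {M M' : S.M3} (h00 : M 0 0 = M' 0 0) (h01 : M 0 1 = M' 0 1)
    (h02 : M 0 2 = M' 0 2) (h10 : M 1 0 = M' 1 0) (h11 : M 1 1 = M' 1 1) (h12 : M 1 2 = M' 1 2)
    (h20 : M 2 0 = M' 2 0) (h21 : M 2 1 = M' 2 1) (h22 : M 2 2 = M' 2 2) : M = M' := by
  ext i j
  fin_cases i <;> fin_cases j <;> assumption

lemma unitary_of_rel {M : S.M3} (h : ∀ i j, M 0 i * S.conj (M 2 j) + M 1 i * S.conj (M 1 j) +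
      M 2 i * S.conj (M 0 j) = S.betaM i j) : M.transpose * S.betaM * M.map S.conj = S.betaM := by
  ext i j
  rw [← h i j]
  simp [Matrix.mul_apply, Fin.sum_univ_three, betaM]
  ring

/-- The element `n(x,y)` of `G`. -/
def nG (x y : S.E) (h : x * S.conj x + y + S.conj y = 0) : S.GG :=
  S.mkG (S.nM x y) (S.unitary_of_rel fun i j => by
    fin_cases i <;> fin_cases j <;> simp [nM, betaM, S.conj_invol]
    linear_combination h)

/-- The element `n'(x,y)` of `G`. -/
def n'G (x y : S.E) (h : x * S.conj x + y + S.conj y = 0) : S.GG :=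
  S.mkG (S.n'M x y) (S.unitary_of_rel fun i j => by
    fin_cases i <;> fin_cases j <;> simp [n'M, betaM, S.conj_invol]
    linear_combination h)

/-- The element `αⁿ = diag(ϖ⁻ⁿ, 1, ϖⁿ)` of `G`. -/
def aG (n : ℤ) : S.GG :=
  S.mkG !![S.ϖ ^ (-n), 0, 0; 0, 1, 0; 0, 0, S.ϖ ^ n] (S.unitary_of_rel fun i j => by
    fin_cases i <;> fin_cases j <;> simp [betaM, S.unif_conj])

/-- The element `β α⁻ᵉ` of `G`. -/
def bG (e : ℤ) : S.GG :=
  S.mkG !![0, 0, S.ϖ ^ (-e); 0, 1, 0; S.ϖ ^ e, 0, 0] (S.unitary_of_rel fun i j => by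
    fin_cases i <;> fin_cases j <;> simp [betaM, S.unif_conj])

lemma mat_aG (n : ℤ) : S.mat (S.aG n) = !![S.ϖ ^ (-n), 0, 0; 0, 1, 0; 0, 0, S.ϖ ^ n] := rfl

lemma mat_bG (e : ℤ) : S.mat (S.bG e) = !![0, 0, S.ϖ ^ (-e); 0, 1, 0; S.ϖ ^ e, 0, 0] := rfl

lemma bG_zero : S.betaE = S.bG 0 := by
  apply S.mat_injective
  rw [mat_bG]
  simp only [neg_zero, zpow_zero]
  rfl

lemma bG_one : S.betaPr = S.bG 1 := by
  apply S.mat_injective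
  have : S.mat S.betaPr = S.betaM * S.alphaMinv := rfl
  rw [this, mat_bG, betaM, alphaMinv]
  simp

lemma aG_mul_aG (m n : ℤ) : S.aG m * S.aG n = S.aG (m + n) := by
  apply S.mat_injective
  rw [mat_mul, mat_aG, mat_aG, mat_aG, Matrix.mul_fin_three]
  simp [zpow_add₀ S.unif_ne, mul_comm]

lemma aG_zero : S.aG 0 = 1 := by
  have := S.aG_mul_aG 0 0
  simpa using this

lemma bG_sq (e : ℤ) : S.bG e * S.bG e = 1 := by
  apply S.mat_injective
  rw [mat_mul, mat_bG, Matrix.mul_fin_three, mat_one, Matrix.one_fin_three]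
  simp

lemma aG_mul_bG (m e : ℤ) : S.aG m * S.bG e = S.bG e * S.aG (-m) := by
  apply S.mat_injective
  rw [mat_mul, mat_mul, mat_aG, mat_bG, mat_aG, Matrix.mul_fin_three, Matrix.mul_fin_three]
  simp [mul_comm]

lemma bG_mul_N {x y : S.E} {k : ℤ} {g : S.GG} (hg : S.mat g = S.nM x y) :
    S.mat (S.bG k * g * S.bG k) = S.n'M (-(S.conj x * S.ϖ ^ k)) (y * S.ϖ ^ (2 * k)) := by
  rw [mat_mul, mat_mul, hg, mat_bG, nM, n'M, Matrix.mul_fin_three, Matrix.mul_fin_three]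
  simp [S.conj_invol, S.unif_conj, two_mul, zpow_add₀ S.unif_ne]
  constructor <;> ring

lemma bG_mul_N' {x y : S.E} {k : ℤ} {g : S.GG} (hg : S.mat g = S.n'M x y) :
    S.mat (S.bG k * g * S.bG k) = S.nM (-(S.conj x * S.ϖ ^ (-k))) (y * S.ϖ ^ (-(2 * k))) := by
  rw [mat_mul, mat_mul, hg, mat_bG, nM, n'M, Matrix.mul_fin_three, Matrix.mul_fin_three]
  simp [S.conj_invol, S.unif_conj, two_mul, zpow_add₀ S.unif_ne]
  constructor <;> ring

lemma bG_conj_N {e k : ℤ} {g : S.GG} (hg : g ∈ S.Nk k) :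
    S.bG e * g * S.bG e ∈ S.N'k (k + 2 * e) := by
  obtain ⟨x, y, h, hy, hm⟩ := hg
  refine ⟨_, _, ?_, S.mul_mem_pE hy (S.zpow_mem_pE le_rfl) rfl, S.bG_mul_N hm⟩
  simp only [map_neg, map_mul, S.conj_invol, S.conj_unif_zpow, two_mul, zpow_add₀ S.unif_ne]
  linear_combination (S.ϖ ^ e) ^ 2 * h

lemma bG_conj_N' {e k : ℤ} {g : S.GG} (hg : g ∈ S.N'k k) :
    S.bG e * g * S.bG e ∈ S.Nk (k - 2 * e) := by
  obtain ⟨x, y, h, hy, hm⟩ := hg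
  refine ⟨_, _, ?_, S.mul_mem_pE hy (S.zpow_mem_pE le_rfl) (by ring), S.bG_mul_N' hm⟩
  simp only [map_neg, map_mul, S.conj_invol, S.conj_unif_zpow,
    show -(2 * e) = -e + -e by ring, zpow_add₀ S.unif_ne]
  linear_combination (S.ϖ ^ (-e)) ^ 2 * h

lemma aG_conj_N' {m k : ℤ} {g : S.GG} (hg : g ∈ S.N'k k) :
    S.aG m * g * S.aG (-m) ∈ S.N'k (k + 2 * m) := by
  obtain ⟨x, y, h, hy, hm⟩ := hg
  refine ⟨x * S.ϖ ^ m, y * S.ϖ ^ (2 * m), ?_, S.mul_mem_pE hy (S.zpow_mem_pE le_rfl) rfl, ?_⟩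
  · simp only [map_mul, S.conj_unif_zpow, two_mul, zpow_add₀ S.unif_ne]
    linear_combination (S.ϖ ^ m) ^ 2 * h
  · rw [mat_mul, mat_mul, hm, mat_aG, mat_aG, n'M, n'M, Matrix.mul_fin_three,
      Matrix.mul_fin_three]
    simp [S.unif_conj, two_mul, zpow_add₀ S.unif_ne]
    constructor <;> ring

lemma aG_conj_N {m k : ℤ} {g : S.GG} (hg : g ∈ S.Nk k) :
    S.aG (-m) * g * S.aG m ∈ S.Nk (k + 2 * m) := by
  obtain ⟨x, y, h, hy, hm⟩ := hg
  refine ⟨x * S.ϖ ^ m, y * S.ϖ ^ (2 * m), ?_, S.mul_mem_pE hy (S.zpow_mem_pE le_rfl) rfl, ?_⟩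
  · simp only [map_mul, S.conj_unif_zpow, two_mul, zpow_add₀ S.unif_ne]
    linear_combination (S.ϖ ^ m) ^ 2 * h
  · rw [mat_mul, mat_mul, hm, mat_aG, mat_aG, nM, nM, Matrix.mul_fin_three,
      Matrix.mul_fin_three]
    simp [S.unif_conj, two_mul, zpow_add₀ S.unif_ne]
    constructor <;> ring

end Matrices

end Setting

namespace Setting

variable (S : Setting)

section Groups

lemma nM_mul {g h : S.GG} {x y x' y' : S.E} (hg : S.mat g = S.nM x y)
    (hh : S.mat h = S.nM x' y') :
    S.mat (g * h) = S.nM (x + x') (y + y' - x * S.conj x') := by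
  rw [mat_mul, hg, hh, nM, nM, nM, Matrix.mul_fin_three]
  apply S.eq_fin_three <;> simp <;> ring

lemma nM_inv {g : S.GG} {x y : S.E} (hg : S.mat g = S.nM x y) :
    S.mat g⁻¹ = S.nM (-x) (S.conj y) := by
  rw [mat_inv_fin, hg]
  simp [nM, S.conj_invol]

lemma norm_mul_rel {x y x' y' : S.E} (h : x * S.conj x + y + S.conj y = 0)
    (h' : x' * S.conj x' + y' + S.conj y' = 0) :
    (x + x') * S.conj (x + x') + (y + y' - x * S.conj x') +
      S.conj (y + y' - x * S.conj x') = 0 := by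
  simp only [map_add, map_sub, map_mul, S.conj_invol]
  linear_combination h + h'

lemma mul_conj_mem_pE {x y x' y' : S.E} {k : ℤ} (h : x * S.conj x + y + S.conj y = 0)
    (h' : x' * S.conj x' + y' + S.conj y' = 0) (hy : y ∈ S.pE k) (hy' : y' ∈ S.pE k) :
    x * S.conj x' ∈ S.pE k := by
  obtain ⟨j, hj | hj⟩ := Int.even_or_odd' k
  · exact S.mul_mem_pE (S.mem_pE_of_norm_eq h hy (j := j) (by omega))
      (S.conj_mem_pE (S.mem_pE_of_norm_eq h' hy' (j := j) (by omega))) (by omega)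
  · exact S.pE_mono (by omega : k ≤ (j + 1) + (j + 1)) (S.mul_mem_pE
      (S.mem_pE_of_norm_eq h hy (by omega))
      (S.conj_mem_pE (S.mem_pE_of_norm_eq h' hy' (by omega))) rfl)

/-- The subgroup `N_k` of `G`. -/
def NkSub (k : ℤ) : Subgroup S.GG where
  carrier := S.Nk k
  one_mem' := ⟨0, 0, by simp, S.zero_mem_pE k, by
    rw [mat_one, nM, Matrix.one_fin_three]; simp⟩
  mul_mem' := by
    rintro g g' ⟨x, y, h, hy, hm⟩ ⟨x', y', h', hy', hm'⟩
    exact ⟨_, _, S.norm_mul_rel h h', S.sub_mem_pE (S.add_mem_pE hy hy')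
      (S.mul_conj_mem_pE h h' hy hy'), S.nM_mul hm hm'⟩
  inv_mem' := by
    rintro g ⟨x, y, h, hy, hm⟩
    refine ⟨_, _, ?_, S.conj_mem_pE hy, S.nM_inv hm⟩
    rw [map_neg, S.conj_invol]
    linear_combination h

lemma NkSub_mono {j k : ℤ} (h : j ≤ k) : S.NkSub k ≤ S.NkSub j := by
  rintro g ⟨x, y, h', hy, hm⟩
  exact ⟨x, y, h', S.pE_mono h hy, hm⟩

lemma NkSub_conj_mem {k : ℤ} {u z : S.GG} (hu : u ∈ S.NkSub k) (hz : z ∈ S.NkSub (k + 1)) :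
    u * z * u⁻¹ ∈ S.NkSub (k + 1) := by
  obtain ⟨a, b, h, hb, hm⟩ := hu
  obtain ⟨x, y, h', hy, hm'⟩ := hz
  have hax : a * S.conj x ∈ S.pE (k + 1) := by
    obtain ⟨j, hj | hj⟩ := Int.even_or_odd' k
    · exact S.mul_mem_pE (S.mem_pE_of_norm_eq h hb (j := j) (by omega))
        (S.conj_mem_pE (S.mem_pE_of_norm_eq h' hy (j := j + 1) (by omega))) (by omega)
    · exact S.mul_mem_pE (S.mem_pE_of_norm_eq h hb (j := j + 1) (by omega))
        (S.conj_mem_pE (S.mem_pE_of_norm_eq h' hy (j := j + 1) (by omega))) (by omega)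
  have hm'' := S.nM_mul (S.nM_mul hm hm') (S.nM_inv hm)
  refine ⟨x, y - a * S.conj x + S.conj (a * S.conj x), ?_,
    S.add_mem_pE (S.sub_mem_pE hy hax) (S.conj_mem_pE hax), ?_⟩
  · simp only [map_add, map_sub, map_mul, S.conj_invol]
    linear_combination h'
  · rw [hm'']
    congr 1
    · ring
    · simp only [map_neg, map_mul, S.conj_invol]
      linear_combination h

/-- The conditions on matrix entries defining `K₀` (`e = 0`) and `K₁` (`e = 1`). -/
def IsIntegral (e : ℤ) (g : S.GG) : Prop :=
  S.mat g 0 0 ∈ S.pE 0 ∧ S.mat g 0 1 ∈ S.pE 0 ∧ S.mat g 0 2 ∈ S.pE (-e) ∧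
  S.mat g 1 0 ∈ S.pE e ∧ S.mat g 1 1 ∈ S.pE 0 ∧ S.mat g 1 2 ∈ S.pE 0 ∧
  S.mat g 2 0 ∈ S.pE e ∧ S.mat g 2 1 ∈ S.pE e ∧ S.mat g 2 2 ∈ S.pE 0

/-- The diagonal elements of `G` with integral entries. -/
def IsIntegralDiag (g : S.GG) : Prop :=
  ∃ a b c : S.E, S.mat g = !![a,0,0;0,b,0;0,0,c] ∧ a ∈ S.pE 0 ∧ b ∈ S.pE 0 ∧ c ∈ S.pE 0

end Groups

end Setting

/-- The description of a chamber in terms of the parameter `e ∈ {0, 1}`. -/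
structure Chamber.HasParam {S : Setting} (C : Chamber S) (e : ℤ) : Prop where
  e_cases : e = 0 ∨ e = 1
  mem_K : ∀ g, g ∈ C.K ↔ S.IsIntegral e g
  βK_eq : C.βK = S.bG e
  Nk_subset_I1 : S.Nk (-e) ⊆ C.I1
  Nk_subset_KoneS : S.Nk (1 - e) ⊆ C.KoneS
  mem_H0 : ∀ g, g ∈ C.H0 ↔ S.IsIntegralDiag g

lemma Chamber.exists_hasParam {S : Setting} (C : Chamber S) : ∃ e, C.HasParam e := by
  rcases C.cases with ⟨hK, hone, hI, hI1, -, hβ, -⟩ | ⟨hK, hone, hI, hI1, -, hβ, -⟩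
  · refine ⟨0, Or.inl rfl, fun g => ?_, hβ.trans S.bG_zero, ?_, ?_, fun g => ?_⟩
    · rw [← SetLike.mem_coe, hK]
      simp [Setting.K0set, Setting.IsIntegral, Fin.forall_fin_succ, S.mem_pE_zero, and_assoc]
    · rintro g ⟨x, y, h, hy, hm⟩
      have hx : x ∈ S.pE 0 := S.mem_pE_of_norm_eq h hy (by omega)
      have hx' := S.conj_mem_pE hx
      rw [neg_zero] at hy
      rw [S.mem_pE_zero] at hx hx' hy
      rw [hI1]
      simp [Setting.I1K0, Setting.IK0, Setting.K0set, hm, Setting.nM, Fin.forall_fin_succ,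
        S.zero_mem_pE, hx, hx', hy, S.O.zero_mem, S.O.one_mem]
    · rintro g ⟨x, y, h, hy, hm⟩
      have hx : x ∈ S.pE 1 := S.mem_pE_of_norm_eq h hy (by omega)
      have hx' := S.conj_mem_pE hx
      rw [sub_zero] at hy
      have hx'' : -S.conj x ∈ S.pE 1 := S.neg_mem_pE hx'
      rw [hone]
      simp [Setting.Kone0, hm, Setting.nM, Fin.forall_fin_succ,
        S.zero_mem_pE, hx, hx'', hy]
    · rw [Chamber.H0, hI]
      constructor
      · rintro ⟨⟨a, b, c, hm⟩, hg, -⟩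
        refine ⟨a, b, c, hm, ?_⟩
        simp only [S.mem_pE_zero]
        exact ⟨by simpa [hm] using hg 0 0, by simpa [hm] using hg 1 1, by simpa [hm] using hg 2 2⟩
      · rintro ⟨a, b, c, hm, ha, hb, hc⟩
        rw [S.mem_pE_zero] at ha hb hc
        refine ⟨⟨a, b, c, hm⟩, ?_⟩
        simp [Setting.IK0, Setting.K0set, hm, Fin.forall_fin_succ,
          S.zero_mem_pE, ha, hb, hc, S.O.zero_mem]
  · refine ⟨1, Or.inr rfl, fun g => ?_, hβ.trans S.bG_one, ?_, ?_, fun g => ?_⟩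
    · rw [← SetLike.mem_coe, hK]
      simp [Setting.K1set, Setting.IsIntegral, S.mem_pE_zero]
    · rintro g ⟨x, y, h, hy, hm⟩
      have hx : x ∈ S.pE 0 := S.mem_pE_of_norm_eq h hy (by omega)
      have hx' := S.conj_mem_pE hx
      rw [S.mem_pE_zero] at hx hx'
      rw [hI1]
      simp [Setting.I1K1, Setting.IK1, Setting.K1set, hm, Setting.nM,
        S.zero_mem_pE, hx, hx', hy, S.O.one_mem]
    · rintro g ⟨x, y, h, hy, hm⟩
      have hx : x ∈ S.pE 0 := S.mem_pE_of_norm_eq h hy (by omega)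
      have hx' := S.conj_mem_pE hx
      have hy' : y ∈ S.pE (-1) := S.pE_mono (by omega) hy
      rw [sub_self] at hy
      rw [S.mem_pE_zero] at hx hx' hy
      rw [hone]
      simp [Setting.Kone1, Setting.K1set, hm, Setting.nM,
        S.zero_mem_pE, hx, hx', hy, hy', S.O.one_mem]
    · rw [Chamber.H0, hI]
      constructor
      · rintro ⟨⟨a, b, c, hm⟩, hg, -⟩
        refine ⟨a, b, c, hm, ?_⟩
        simp only [S.mem_pE_zero]
        simp only [Setting.K1set, Set.mem_ofPred_eq, hm] at hg
        exact ⟨by simpa using hg.1, by simpa using hg.2.2.2.2.1,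
          by simpa using hg.2.2.2.2.2.2.2.2⟩
      · rintro ⟨a, b, c, hm, ha, hb, hc⟩
        rw [S.mem_pE_zero] at ha hb hc
        refine ⟨⟨a, b, c, hm⟩, ?_⟩
        simp [Setting.IK1, Setting.K1set, hm,
          S.zero_mem_pE, ha, hb, hc, S.O.zero_mem]

namespace Setting

variable (S : Setting)

section Decompositions

lemma n'M_inv {g : S.GG} {x y : S.E} (hg : S.mat g = S.n'M x y) :
    S.mat g⁻¹ = S.n'M (-x) (S.conj y) := by
  rw [mat_inv_fin, hg]
  simp [n'M, S.conj_invol]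

lemma diag_rel {d : S.GG} {a b c : S.E} (hd : S.mat d = !![a,0,0;0,b,0;0,0,c]) :
    a * S.conj c = 1 ∧ b * S.conj b = 1 := by
  have h1 := S.col_rel d 0 2
  have h2 := S.col_rel d 1 1
  simp [hd, betaM] at h1 h2
  exact ⟨h1, h2⟩

/-- An element of `G` with nonzero upper left entry lies in `N' H N`. -/
lemma exists_eq_n'_mul_diag_mul_n {g : S.GG} (h0 : S.mat g 0 0 ≠ 0) :
    ∃ (n' d n : S.GG) (a b x y : S.E), g = n' * d * n ∧
      a * S.conj a + b + S.conj b = 0 ∧ S.mat n' = S.n'M a b ∧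
      x * S.conj x + y + S.conj y = 0 ∧ S.mat n = S.nM x y ∧
      d ∈ S.Hset ∧ S.mat d 0 0 = S.mat g 0 0 ∧
      b = S.mat g 2 0 * (S.mat g 0 0)⁻¹ ∧ y = S.mat g 0 2 * (S.mat g 0 0)⁻¹ := by
  have h0' := S.conj_ne_zero h0
  have hc := S.col_rel g 0 0
  have hr := S.col_rel g⁻¹ 2 2
  rw [mat_inv_fin] at hr
  simp [betaM, S.conj_invol] at hc hr
  obtain ⟨a, ha⟩ : ∃ a, a = S.mat g 1 0 * (S.mat g 0 0)⁻¹ := ⟨_, rfl⟩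
  obtain ⟨b, hb⟩ : ∃ b, b = S.mat g 2 0 * (S.mat g 0 0)⁻¹ := ⟨_, rfl⟩
  obtain ⟨x, hx⟩ : ∃ x, x = S.mat g 0 1 * (S.mat g 0 0)⁻¹ := ⟨_, rfl⟩
  obtain ⟨y, hy⟩ : ∃ y, y = S.mat g 0 2 * (S.mat g 0 0)⁻¹ := ⟨_, rfl⟩
  have hab : a * S.conj a + b + S.conj b = 0 := by
    rw [ha, hb]
    simp only [map_mul, map_inv₀]
    field_simp
    linear_combination hc
  have hxy : x * S.conj x + y + S.conj y = 0 := by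
    rw [hx, hy]
    simp only [map_mul, map_inv₀]
    field_simp
    linear_combination hr
  have ha' : S.mat g 1 0 = a * S.mat g 0 0 := by rw [ha]; field_simp
  have hb' : S.mat g 2 0 = b * S.mat g 0 0 := by rw [hb]; field_simp
  have hx' : S.mat g 0 1 = x * S.mat g 0 0 := by rw [hx]; field_simp
  have hy' : S.mat g 0 2 = y * S.mat g 0 0 := by rw [hy]; field_simp
  obtain ⟨d, hd⟩ : ∃ d, d = (S.n'G a b hab)⁻¹ * g * (S.nG x y hxy)⁻¹ := ⟨_, rfl⟩
  have hm : S.mat d = S.n'M (-a) (S.conj b) * S.mat g * S.nM (-x) (S.conj y) := by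
    rw [hd, mat_mul, mat_mul, S.n'M_inv (x := a) (y := b) rfl, S.nM_inv (x := x) (y := y) rfl]
  have h00 : S.mat d 0 0 = S.mat g 0 0 := by
    rw [hm]; simp [Matrix.mul_apply, Fin.sum_univ_three, n'M, nM, Matrix.vecMul, dotProduct]
  have h10 : S.mat d 1 0 = 0 := by
    rw [hm]; simp [Matrix.mul_apply, Fin.sum_univ_three, n'M, nM, Matrix.vecMul, dotProduct, ha']
  have h20 : S.mat d 2 0 = 0 := by
    rw [hm]; simp [Matrix.mul_apply, Fin.sum_univ_three, n'M, nM, Matrix.vecMul, dotProduct, ha', hb']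
    linear_combination S.mat g 0 0 * hab
  have h01 : S.mat d 0 1 = 0 := by
    rw [hm]; simp [Matrix.mul_apply, Fin.sum_univ_three, n'M, nM, Matrix.vecMul, dotProduct, hx']; ring
  have h02 : S.mat d 0 2 = 0 := by
    rw [hm]; simp [Matrix.mul_apply, Fin.sum_univ_three, n'M, nM, Matrix.vecMul, dotProduct, hx', hy']
    linear_combination S.mat g 0 0 * hxy
  have r01 := S.col_rel d 0 1
  have r11 := S.col_rel d 1 1
  have r12 := S.col_rel d 1 2
  simp [h00, h10, h20, h01, betaM, h0] at r01
  simp [h01, r01, betaM] at r11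
  have h11 : S.mat d 1 1 ≠ 0 := left_ne_zero_of_mul_eq_one r11
  simp [h02, h01, r01, betaM, h11] at r12
  refine ⟨S.n'G a b hab, d, S.nG x y hxy, a, b, x, y, ?_, hab, rfl, hxy, rfl,
    ⟨S.mat d 0 0, S.mat d 1 1, S.mat d 2 2, ?_⟩, h00, hb, hy⟩
  · rw [hd]; group
  · exact S.eq_fin_three rfl h01 h02 h10 rfl r12 h20 r01 rfl

lemma isIntegralDiag_of_ord {d : S.GG} (hd : d ∈ S.Hset) (h : S.ord (S.mat d 0 0) = 0) :
    S.IsIntegralDiag d := by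
  obtain ⟨a, b, c, hm⟩ := hd
  obtain ⟨hac, hbb⟩ := S.diag_rel hm
  have ha : a ≠ 0 := left_ne_zero_of_mul_eq_one hac
  have hb : b ≠ 0 := left_ne_zero_of_mul_eq_one hbb
  have hc : c ≠ 0 := fun h => by simp [h] at hac
  have h1 := congrArg S.ord hac
  have h2 := congrArg S.ord hbb
  rw [S.ord_mul ha (S.conj_ne_zero hc), S.ord_conj hc, S.ord_one] at h1
  rw [S.ord_mul hb (S.conj_ne_zero hb), S.ord_conj hb, S.ord_one] at h2
  have h3 : S.ord a = 0 := by simpa [hm] using h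
  refine ⟨a, b, c, hm, ?_, ?_, ?_⟩
  · rw [S.mem_pE_iff_le_ord ha]; omega
  · rw [S.mem_pE_iff_le_ord hb]; omega
  · rw [S.mem_pE_iff_le_ord hc]; omega

lemma exists_eq_integral_n'_mul_diag_mul_n {g : S.GG} (h0 : S.mat g 0 0 ≠ 0)
    (h : S.ord (S.mat g 0 0) = 0) {i j : ℤ} (hj : S.mat g 2 0 ∈ S.pE j)
    (hi : S.mat g 0 2 ∈ S.pE i) :
    ∃ n' ∈ S.N'k j, ∃ d, S.IsIntegralDiag d ∧ ∃ n ∈ S.Nk i, g = n' * d * n := by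
  obtain ⟨n', d, n, a, b, x, y, hg, hab, hn', hxy, hn, hd, hd0, rfl, rfl⟩ :=
    S.exists_eq_n'_mul_diag_mul_n h0
  have hinv : (S.mat g 0 0)⁻¹ ∈ S.pE 0 := by
    rw [S.mem_pE_iff_le_ord (inv_ne_zero h0), S.ord_inv h0, h, neg_zero]
  exact ⟨n', ⟨_, _, hab, S.mul_mem_pE hj hinv (add_zero j), hn'⟩, d,
    S.isIntegralDiag_of_ord hd (by rw [hd0, h]), n,
    ⟨_, _, hxy, S.mul_mem_pE hi hinv (add_zero i), hn⟩, hg⟩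

lemma IsIntegralDiag.inv {d : S.GG} (hd : S.IsIntegralDiag d) : S.IsIntegralDiag d⁻¹ := by
  obtain ⟨a, b, c, hm, ha, hb, hc⟩ := hd
  refine ⟨S.conj c, S.conj b, S.conj a, ?_, S.conj_mem_pE hc, S.conj_mem_pE hb,
    S.conj_mem_pE ha⟩
  rw [mat_inv_fin, hm]
  simp

lemma IsIntegralDiag.bG_conj {d : S.GG} (hd : S.IsIntegralDiag d) (e : ℤ) :
    S.IsIntegralDiag (S.bG e * d * S.bG e) := by
  obtain ⟨a, b, c, hm, ha, hb, hc⟩ := hd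
  refine ⟨c, b, a, ?_, hc, hb, ha⟩
  rw [mat_mul, mat_mul, hm, mat_bG, Matrix.mul_fin_three, Matrix.mul_fin_three]
  have h0 : S.ϖ ^ e ≠ 0 := zpow_ne_zero _ S.unif_ne
  apply S.eq_fin_three <;> simp <;> field_simp

lemma diag_mul_comm {d d' : S.GG} (hd : d ∈ S.Hset) (hd' : d' ∈ S.Hset) :
    d * d' = d' * d := by
  obtain ⟨a, b, c, hm⟩ := hd
  obtain ⟨a', b', c', hm'⟩ := hd'
  apply S.mat_injective
  rw [mat_mul, mat_mul, hm, hm', Matrix.mul_fin_three, Matrix.mul_fin_three]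
  simp [mul_comm]

lemma IsIntegralDiag.mem_Hset {d : S.GG} (hd : S.IsIntegralDiag d) : d ∈ S.Hset := by
  obtain ⟨a, b, c, hm, -⟩ := hd
  exact ⟨a, b, c, hm⟩

lemma aG_mem_Hset (m : ℤ) : S.aG m ∈ S.Hset := ⟨_, _, _, rfl⟩

lemma Hset_mul {d d' : S.GG} (hd : d ∈ S.Hset) (hd' : d' ∈ S.Hset) : d * d' ∈ S.Hset := by
  obtain ⟨a, b, c, hm⟩ := hd
  obtain ⟨a', b', c', hm'⟩ := hd'
  refine ⟨a * a', b * b', c * c', ?_⟩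
  rw [mat_mul, hm, hm', Matrix.mul_fin_three]
  simp

lemma exists_eq_integralDiag_mul_aG {d : S.GG} (hd : d ∈ S.Hset) :
    ∃ h m, S.IsIntegralDiag h ∧ d = h * S.aG m := by
  have hd' := hd
  obtain ⟨a, b, c, hm⟩ := hd'
  obtain ⟨hac, -⟩ := S.diag_rel hm
  have ha : a ≠ 0 := left_ne_zero_of_mul_eq_one hac
  refine ⟨d * S.aG (S.ord a), -S.ord a,
    S.isIntegralDiag_of_ord (S.Hset_mul hd (S.aG_mem_Hset _)) ?_, ?_⟩
  · have : S.mat (d * S.aG (S.ord a)) 0 0 = a * S.ϖ ^ (-S.ord a) := by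
      rw [mat_mul, hm, mat_aG, Matrix.mul_fin_three]
      simp
    rw [this, S.ord_mul ha (zpow_ne_zero _ S.unif_ne), S.ord_zpow, add_neg_cancel]
  · rw [mul_assoc, S.aG_mul_aG, add_neg_cancel, S.aG_zero, mul_one]

/-- Conjugation of `n(x,y)` by a diagonal element. -/
lemma diag_conj_N {d g : S.GG} {a b c x y : S.E} (hd : S.mat d = !![a,0,0;0,b,0;0,0,c])
    (h : x * S.conj x + y + S.conj y = 0) (hg : S.mat g = S.nM x y) :
    ∃ x', x' * S.conj x' + a * S.conj a * y + S.conj (a * S.conj a * y) = 0 ∧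
      S.mat (d * g * d⁻¹) = S.nM x' (a * S.conj a * y) := by
  obtain ⟨hac, hbb⟩ := S.diag_rel hd
  refine ⟨a * S.conj b * x, ?_, ?_⟩
  · simp only [map_mul, S.conj_invol]
    linear_combination a * S.conj a * h + a * S.conj a * x * S.conj x * hbb
  · have hc : c * S.conj a = 1 := by
      have := congrArg S.conj hac
      rw [map_mul, S.conj_invol, map_one] at this
      rw [mul_comm, this]
    rw [mat_mul, mat_mul, mat_inv_fin, hd, hg, nM, nM, Matrix.mul_fin_three]
    simp
    refine ⟨⟨hac, ?_, ?_⟩, ⟨hbb, ?_⟩, hc⟩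
    all_goals first | ring1 | (rw [S.conj_invol]; ring1)

lemma IsIntegralDiag.conj_mem_NkSub {d u : S.GG} {k : ℤ} (hd : S.IsIntegralDiag d)
    (hu : u ∈ S.NkSub k) : d * u * d⁻¹ ∈ S.NkSub k := by
  obtain ⟨a, b, c, hm, ha, -⟩ := hd
  obtain ⟨x, y, h, hy, hg⟩ := hu
  obtain ⟨x', h', hg'⟩ := S.diag_conj_N hm h hg
  exact ⟨x', _, h', S.mul_mem_pE (S.mul_mem_pE ha (S.conj_mem_pE ha) (add_zero 0)) hy
    (zero_add k), hg'⟩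

end Decompositions

end Setting

namespace Setting

variable (S : Setting)

section Filtration

lemma exists_residue (k : ℤ) : ∃ r : S.E → S.kE, ∀ z ∈ S.pE k, ∀ z' ∈ S.pE k, r z = r z' →
    z - z' ∈ S.pE (k + 1) := by
  refine ⟨fun z => if h : S.ϖ ^ (-k) * z ∈ S.O then S.resmap ⟨_, h⟩ else 0,
    fun z hz z' hz' h => ?_⟩
  have h1 := S.mem_pE_iff.mp hz
  have h2 := S.mem_pE_iff.mp hz'
  beta_reduce at h
  rw [dif_pos h1, dif_pos h2, resmap, Ideal.Quotient.eq, S.hmI] at h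
  obtain ⟨w, hw, h⟩ := h
  refine ⟨w, hw, ?_⟩
  have h0 : S.ϖ ^ k ≠ 0 := zpow_ne_zero _ S.unif_ne
  have h3 : S.ϖ ^ (-k) * z - S.ϖ ^ (-k) * z' = S.ϖ * w := h
  rw [zpow_add_one₀ S.unif_ne, mul_assoc, ← h3, zpow_neg]
  field_simp

lemma relIndex_NkSub_ne_zero (k : ℤ) : (S.NkSub (k + 1)).relIndex (S.NkSub k) ≠ 0 := by
  obtain ⟨j, hj1, hj2⟩ : ∃ j : ℤ, 2 * j ≤ k + 1 ∧ k ≤ 2 * j := ⟨(k + 1) / 2, by omega, by omega⟩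
  obtain ⟨r, hr⟩ := S.exists_residue j
  obtain ⟨s, hs⟩ := S.exists_residue k
  have hfin : Finite (S.NkSub k ⧸ (S.NkSub (k + 1)).subgroupOf (S.NkSub k)) := by
    refine Finite.of_injective (β := S.kE × S.kE)
      (fun c => (r (S.mat c.out 0 1), s (S.mat c.out 0 2))) fun c c' h => ?_
    obtain ⟨h1, h2⟩ := Prod.mk.inj h
    rw [← c.out_eq, ← c'.out_eq]
    refine QuotientGroup.eq.mpr ?_
    rw [Subgroup.mem_subgroupOf]
    obtain ⟨x, y, hxy, hy, hm⟩ := c.out.2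
    obtain ⟨x', y', hxy', hy', hm'⟩ := c'.out.2
    have hx := S.mem_pE_of_norm_eq hxy hy hj1
    have hx' := S.mem_pE_of_norm_eq hxy' hy' hj1
    have e1 : x' - x ∈ S.pE (j + 1) := by
      refine hr _ hx' _ hx ?_
      simpa [hm, hm', nM] using h1.symm
    have e2 : y' - y ∈ S.pE (k + 1) := by
      refine hs _ hy' _ hy ?_
      simpa [hm, hm', nM] using h2.symm
    have hinv : -x * S.conj (-x) + S.conj y + S.conj (S.conj y) = 0 := by
      rw [map_neg, S.conj_invol]
      linear_combination hxy
    refine ⟨_, _, S.norm_mul_rel hinv hxy', ?_, S.nM_mul (S.nM_inv hm) hm'⟩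
    have : S.conj y + y' - -x * S.conj x' = (y' - y) + x * S.conj (x' - x) := by
      rw [map_sub]
      linear_combination hxy
    rw [this]
    exact S.add_mem_pE e2 (S.pE_mono (by omega)
      (S.mul_mem_pE hx (S.conj_mem_pE e1) (k := j + (j + 1)) rfl))
  exact Subgroup.index_ne_zero_of_finite

lemma exists_mem_NkSub_not_mem (k : ℤ) : ∃ u ∈ S.NkSub k, u ∉ S.NkSub (k + 1) := by
  obtain ⟨t, ht0, ht, htr⟩ := S.exists_trace_zero k
  refine ⟨S.nG 0 t (by simpa using htr), ⟨0, t, by simpa using htr, ?_, rfl⟩, ?_⟩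
  · rw [S.mem_pE_iff_le_ord ht0, ht]
  · rintro ⟨x, y, -, hy, hm⟩
    have : t = y := by simpa [nG, nM] using congrFun (congrFun hm 0) 2
    rw [← this, S.mem_pE_iff_le_ord ht0] at hy
    omega

lemma nM_pow {g : S.GG} {x y : S.E} (hg : S.mat g = S.nM x y) (j : ℕ) :
    ∃ z : ℤ, S.mat (g ^ j) = S.nM (j * x) (j * y - z * (x * S.conj x)) := by
  induction j with
  | zero =>
    refine ⟨0, ?_⟩
    rw [pow_zero, mat_one, nM, Matrix.one_fin_three]
    simp
  | succ j ih =>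
    obtain ⟨z, hz⟩ := ih
    refine ⟨z + j, ?_⟩
    rw [pow_succ, S.nM_mul hz hg]
    congr 1
    · push_cast
      ring
    · push_cast
      ring

lemma pow_p_sq_mem {k : ℤ} {u : S.GG} (hu : u ∈ S.NkSub k) :
    u ^ S.p ^ 2 ∈ S.NkSub (k + 1) := by
  have hp := S.natCast_p_mem_pE
  obtain ⟨x, y, h, hy, hm⟩ := hu
  obtain ⟨z, hz⟩ := S.nM_pow hm S.p
  obtain ⟨x₁, y₁, h₁, hy₁, hm₁⟩ := (S.NkSub k).pow_mem ⟨x, y, h, hy, hm⟩ S.p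
  have hx₁ : x₁ = S.p * x := by
    simpa [hz, nM] using (congrFun (congrFun hm₁ 0) 1).symm
  obtain ⟨z₁, hz₁⟩ := S.nM_pow hm₁ S.p
  obtain ⟨x₂, y₂, h₂, hy₂, hm₂⟩ := (S.NkSub k).pow_mem ⟨x₁, y₁, h₁, hy₁, hm₁⟩ S.p
  have hy₂' : y₂ = S.p * y₁ - z₁ * (x₁ * S.conj x₁) := by
    simpa [hz₁, nM] using (congrFun (congrFun hm₂ 0) 2).symm
  rw [pow_two, pow_mul]
  refine ⟨x₂, y₂, h₂, ?_, hm₂⟩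
  rw [hy₂', hx₁, map_mul, map_natCast]
  refine S.sub_mem_pE (S.mul_mem_pE hp hy₁ (by ring)) ?_
  have hxx := S.mul_conj_mem_pE h h hy hy
  have : S.p * x * (S.p * S.conj x) = S.p * (S.p * (x * S.conj x)) := by ring
  rw [this]
  have h3 : (S.p : S.E) * (x * S.conj x) ∈ S.pE k :=
    S.pE_mono (by omega) (S.mul_mem_pE hp hxx (k := 1 + k) rfl)
  exact S.mul_mem_pE (S.intCast_mem_pE _) (S.mul_mem_pE hp h3 rfl) (by ring)

lemma big_cell {e : ℤ} {u : S.GG} (hu : u ∈ S.NkSub (-e)) (hu1 : u ∉ S.NkSub (1 - e)) :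
    ∃ u' ∈ S.NkSub (-e), ∃ h, S.IsIntegralDiag h ∧ ∃ n ∈ S.NkSub (-e),
      u * S.bG e = S.bG e * u' * S.bG e * h * n := by
  obtain ⟨x, y, h, hy, hm⟩ := hu
  have hy1 : y ∉ S.pE (1 - e) := fun hy1 => hu1 ⟨x, y, h, hy1, hm⟩
  have hy0 : y ≠ 0 := fun h0 => hy1 (h0 ▸ S.zero_mem_pE _)
  rw [S.mem_pE_iff_le_ord hy0] at hy hy1
  have hϖ : S.ϖ ^ e ≠ 0 := zpow_ne_zero _ S.unif_ne
  have hmg : S.mat (u * S.bG e) = S.nM x y * S.mat (S.bG e) := by rw [mat_mul, hm]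
  have g00 : S.mat (u * S.bG e) 0 0 = y * S.ϖ ^ e := by
    rw [hmg, S.mat_bG, Setting.nM, Matrix.mul_fin_three]; simp
  have g20 : S.mat (u * S.bG e) 2 0 = S.ϖ ^ e := by
    rw [hmg, S.mat_bG, Setting.nM, Matrix.mul_fin_three]; simp
  have g02 : S.mat (u * S.bG e) 0 2 = S.ϖ ^ (-e) := by
    rw [hmg, S.mat_bG, Setting.nM, Matrix.mul_fin_three]; simp
  obtain ⟨n', hn', d, hd, n, hn, hg⟩ := S.exists_eq_integral_n'_mul_diag_mul_n
    (g := u * S.bG e) (i := -e) (j := e) (by rw [g00]; exact mul_ne_zero hy0 hϖ)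
    (by rw [g00, S.ord_mul hy0 hϖ, S.ord_zpow]; omega)
    (by rw [g20]; exact S.zpow_mem_pE le_rfl) (by rw [g02]; exact S.zpow_mem_pE le_rfl)
  refine ⟨S.bG e * n' * S.bG e, ?_, d, hd, n, hn, ?_⟩
  · have := S.bG_conj_N' (e := e) hn'
    rwa [show e - 2 * e = -e by ring] at this
  · rw [hg]
    have hb := S.bG_sq e
    simp only [← mul_assoc]
    rw [hb, one_mul, mul_assoc n' (S.bG e), hb, mul_one]

end Filtration

end Setting

namespace Chamber.HasParam

variable {S : Setting} {C : Chamber S} {e : ℤ} (hC : C.HasParam e)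

section
include hC

lemma NkSub_le_K : S.NkSub (-e) ≤ C.K := by
  rintro g ⟨x, y, h, hy, hm⟩
  rw [hC.mem_K]
  have he := hC.e_cases
  have hx : x ∈ S.pE 0 := S.mem_pE_of_norm_eq h hy (by omega)
  have h1 : (1 : S.E) ∈ S.pE 0 := S.mem_pE_zero.mpr S.O.one_mem
  have hx' := S.neg_mem_pE (S.conj_mem_pE hx)
  simp [Setting.IsIntegral, hm, Setting.nM, S.zero_mem_pE, hx, hx', hy, h1]

lemma N'k_subset_K : S.N'k e ⊆ C.K := by
  rintro g ⟨x, y, h, hy, hm⟩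
  rw [SetLike.mem_coe, hC.mem_K]
  have he := hC.e_cases
  have hx : x ∈ S.pE e := S.mem_pE_of_norm_eq h hy (by omega)
  have h1 : (1 : S.E) ∈ S.pE 0 := S.mem_pE_zero.mpr S.O.one_mem
  have hx' := S.neg_mem_pE (S.conj_mem_pE hx)
  simp [Setting.IsIntegral, hm, Setting.n'M, S.zero_mem_pE, hx, hx', hy, h1]

lemma bG_mem_K : S.bG e ∈ C.K := by
  rw [hC.mem_K]
  have h1 : (1 : S.E) ∈ S.pE 0 := S.mem_pE_zero.mpr S.O.one_mem
  have h2 := S.zpow_mem_pE (le_refl e)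
  have h3 := S.zpow_mem_pE (le_refl (-e))
  rw [zpow_neg] at h3
  simp [Setting.IsIntegral, S.mat_bG, S.zero_mem_pE, h1, h2, h3]

lemma diag_mem_K {d : S.GG} (hd : S.IsIntegralDiag d) : d ∈ C.K := by
  obtain ⟨a, b, c, hm, ha, hb, hc⟩ := hd
  rw [hC.mem_K]
  simp [Setting.IsIntegral, hm, S.zero_mem_pE, ha, hb, hc]

lemma ord_two_zero {k : S.GG} (hk : k ∈ C.K) (h : S.mat k 0 0 ∈ S.pE 1) :
    S.mat k 2 0 ∉ S.pE (1 + e) := by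
  intro h2
  obtain ⟨-, -, h02, -, -, h12, -, -, h22⟩ := (hC.mem_K k).mp hk
  have r00 := S.col_rel k 0 0
  have r02 := S.col_rel k 0 2
  simp [Setting.betaM] at r00 r02
  have h10 : S.mat k 1 0 ∈ S.pE (1 + e) := by
    refine S.mem_pE_of_norm_eq (y := S.mat k 0 0 * S.conj (S.mat k 2 0)) (k := 2 + e) ?_
      (S.mul_mem_pE h (S.conj_mem_pE h2) (by ring)) ?_
    · rw [map_mul, S.conj_invol]
      linear_combination r00
    · have := hC.e_cases
      omega
  have h1 : (1 : S.E) ∈ S.pE 1 := by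
    rw [← r02]
    refine S.add_mem_pE (S.add_mem_pE (S.mul_mem_pE h (S.conj_mem_pE h22) (add_zero 1)) ?_) ?_
    · refine S.pE_mono ?_ (S.mul_mem_pE h10 (S.conj_mem_pE h12) rfl)
      have := hC.e_cases
      omega
    · exact S.mul_mem_pE h2 (S.conj_mem_pE h02) (by ring)
  rw [S.mem_pE_iff_le_ord one_ne_zero, S.ord_one] at h1
  omega

lemma decomp {k : S.GG} (hk : k ∈ C.K) :
    (∃ u ∈ S.NkSub (-e), ∃ h, S.IsIntegralDiag h ∧ ∃ n ∈ S.NkSub (-e),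
      k = S.bG e * u * S.bG e * h * n) ∨
    ∃ u ∈ S.NkSub (1 - e), ∃ h, S.IsIntegralDiag h ∧ ∃ n ∈ S.NkSub (-e),
      k = u * S.bG e * h * n := by
  have hb := S.bG_sq e
  obtain ⟨h00, -, h02, -, -, -, h20, -, h22⟩ := (hC.mem_K k).mp hk
  by_cases h : S.mat k 0 0 ∈ S.pE 1
  · right
    have h2 := hC.ord_two_zero hk h
    have hne : S.mat k 2 0 ≠ 0 := fun h0 => h2 (h0 ▸ S.zero_mem_pE _)
    have hϖ : S.ϖ ^ (-e) ≠ 0 := zpow_ne_zero _ S.unif_ne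
    have hmg : S.mat (S.bG e * k) = S.mat (S.bG e) * S.mat k := S.mat_mul _ _
    have g00 : S.mat (S.bG e * k) 0 0 = S.ϖ ^ (-e) * S.mat k 2 0 := by
      rw [hmg, S.mat_bG]; simp [Matrix.mul_apply, Fin.sum_univ_three]
    have g20 : S.mat (S.bG e * k) 2 0 = S.ϖ ^ e * S.mat k 0 0 := by
      rw [hmg, S.mat_bG]; simp [Matrix.mul_apply, Fin.sum_univ_three]
    have g02 : S.mat (S.bG e * k) 0 2 = S.ϖ ^ (-e) * S.mat k 2 2 := by
      rw [hmg, S.mat_bG]; simp [Matrix.mul_apply, Fin.sum_univ_three]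
    rw [S.mem_pE_iff_le_ord hne] at h2 h20
    obtain ⟨n', hn', d, hd, n, hn, hg⟩ := S.exists_eq_integral_n'_mul_diag_mul_n
      (g := S.bG e * k) (i := -e) (j := 1 + e) (by rw [g00]; exact mul_ne_zero hϖ hne)
      (by rw [g00, S.ord_mul hϖ hne, S.ord_zpow]; omega)
      (by rw [g20]; exact S.mul_mem_pE (S.zpow_mem_pE le_rfl) h (by ring))
      (by rw [g02]; exact S.mul_mem_pE (S.zpow_mem_pE le_rfl) h22 (by ring))
    refine ⟨S.bG e * n' * S.bG e, ?_, d, hd, n, hn, ?_⟩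
    · have := S.bG_conj_N' (e := e) hn'
      rwa [show 1 + e - 2 * e = 1 - e by ring] at this
    · rw [mul_assoc _ (S.bG e) (S.bG e), hb, mul_one, mul_assoc, mul_assoc, ← mul_assoc n', ← hg,
        ← mul_assoc, hb, one_mul]
  · left
    have hne : S.mat k 0 0 ≠ 0 := fun h0 => h (h0 ▸ S.zero_mem_pE _)
    rw [S.mem_pE_iff_le_ord hne] at h h00
    obtain ⟨n', hn', d, hd, n, hn, hg⟩ := S.exists_eq_integral_n'_mul_diag_mul_n
      (g := k) (i := -e) (j := e) hne (by omega) h20 h02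
    refine ⟨S.bG e * n' * S.bG e, ?_, d, hd, n, hn, ?_⟩
    · have := S.bG_conj_N' (e := e) hn'
      rwa [show e - 2 * e = -e by ring] at this
    · simp only [← mul_assoc]
      rw [hb, one_mul, mul_assoc n', hb, mul_one]
      exact hg

end

/-- The rank one datum carried by the group `K`. -/
def datum : RankOneDatum S.p ↥C.K where
  N := (S.NkSub (-e)).subgroupOf C.K
  N₁ := (S.NkSub (1 - e)).subgroupOf C.K
  H := {h | S.IsIntegralDiag (h : S.GG)}
  β := ⟨S.bG e, hC.bG_mem_K⟩
  conj_mem u hu z hz := by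
    have := S.NkSub_conj_mem (k := -e) (u := (u : S.GG)) (z := (z : S.GG)) hu
      (by rwa [neg_add_eq_sub])
    rwa [neg_add_eq_sub] at this
  fin := by
    have h1 := S.relIndex_NkSub_ne_zero (-e)
    rw [neg_add_eq_sub, ← Subgroup.relIndex_subgroupOf hC.NkSub_le_K] at h1
    have : (((S.NkSub (1 - e)).subgroupOf C.K).subgroupOf
      ((S.NkSub (-e)).subgroupOf C.K)).FiniteIndex := ⟨h1⟩
    exact Subgroup.finite_quotient_of_finiteIndex
  exists_not_mem := by
    obtain ⟨u, hu, hu1⟩ := S.exists_mem_NkSub_not_mem (-e)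
    rw [neg_add_eq_sub] at hu1
    exact ⟨⟨u, hC.NkSub_le_K hu⟩, hu, hu1⟩
  pow_mem u hu := by
    have := S.pow_p_sq_mem (k := -e) (u := (u : S.GG)) hu
    rwa [neg_add_eq_sub] at this
  β_sq := Subtype.ext (S.bG_sq e)
  H_inv h hh := Setting.IsIntegralDiag.inv S hh
  H_N h hh u hu := Setting.IsIntegralDiag.conj_mem_NkSub S hh hu
  H_N₁ h hh u hu := Setting.IsIntegralDiag.conj_mem_NkSub S hh hu
  β_H h hh := Setting.IsIntegralDiag.bG_conj S hh e
  big_cell u hu hu1 := by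
    obtain ⟨u', hu', h, hh, n, hn, heq⟩ := S.big_cell (u := (u : S.GG)) hu hu1
    exact ⟨⟨u', hC.NkSub_le_K hu'⟩, hu', ⟨h, hC.diag_mem_K hh⟩, hh, ⟨n, hC.NkSub_le_K hn⟩, hn,
      Subtype.ext heq⟩
  decomp k := by
    have hle : S.NkSub (1 - e) ≤ S.NkSub (-e) := S.NkSub_mono (by omega)
    rcases hC.decomp k.2 with ⟨u, hu, h, hh, n, hn, heq⟩ | ⟨u, hu, h, hh, n, hn, heq⟩
    · exact Or.inl ⟨⟨u, hC.NkSub_le_K hu⟩, hu, ⟨h, hC.diag_mem_K hh⟩, hh,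
        ⟨n, hC.NkSub_le_K hn⟩, hn, Subtype.ext heq⟩
    · exact Or.inr ⟨⟨u, hC.NkSub_le_K (hle hu)⟩, hu, ⟨h, hC.diag_mem_K hh⟩, hh,
        ⟨n, hC.NkSub_le_K hn⟩, hn, Subtype.ext heq⟩

end Chamber.HasParam

namespace Setting

variable (S : Setting)

lemma Nset_mul {g h : S.GG} (hg : g ∈ S.Nset) (hh : h ∈ S.Nset) : g * h ∈ S.Nset := by
  obtain ⟨x, y, hxy, hm⟩ := hg
  obtain ⟨x', y', hxy', hm'⟩ := hh
  exact ⟨_, _, S.norm_mul_rel hxy hxy', S.nM_mul hm hm'⟩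

lemma Hset_inv {d : S.GG} (hd : d ∈ S.Hset) : d⁻¹ ∈ S.Hset := by
  obtain ⟨a, b, c, hm⟩ := hd
  refine ⟨S.conj c, S.conj b, S.conj a, ?_⟩
  rw [mat_inv_fin, hm]
  simp

lemma Hset_conj_mem_Nset {d n : S.GG} (hd : d ∈ S.Hset) (hn : n ∈ S.Nset) :
    d * n * d⁻¹ ∈ S.Nset := by
  obtain ⟨a, b, c, hm⟩ := hd
  obtain ⟨x, y, h, hn⟩ := hn
  obtain ⟨x', h', hm'⟩ := S.diag_conj_N hm h hn
  exact ⟨x', _, h', hm'⟩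

lemma N'k_subset {j k : ℤ} (h : j ≤ k) : S.N'k k ⊆ S.N'k j := by
  rintro g ⟨x, y, h', hy, hm⟩
  exact ⟨x, y, h', S.pE_mono h hy, hm⟩

lemma mat_bG_mul (e : ℤ) (g : S.GG) :
    S.mat (S.bG e * g) 0 0 = S.ϖ ^ (-e) * S.mat g 2 0 ∧
    S.mat (S.bG e * g) 2 0 = S.ϖ ^ e * S.mat g 0 0 ∧
    S.mat (S.bG e * g) 0 2 = S.ϖ ^ (-e) * S.mat g 2 2 := by
  rw [mat_mul, mat_bG]
  simp [Matrix.mul_apply, Fin.sum_univ_three]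

lemma mat_mul_bG (e : ℤ) (g : S.GG) :
    S.mat (g * S.bG e) 0 0 = S.mat g 0 2 * S.ϖ ^ e ∧
    S.mat (g * S.bG e) 2 0 = S.mat g 2 2 * S.ϖ ^ e ∧
    S.mat (g * S.bG e) 0 2 = S.mat g 0 0 * S.ϖ ^ (-e) := by
  rw [mat_mul, mat_bG]
  simp [Matrix.mul_apply, Fin.sum_univ_three]

end Setting

namespace Chamber.HasParam

variable {S : Setting} {C : Chamber S} {e : ℤ} (hC : C.HasParam e)

include hC

/-- The Iwasawa decomposition. -/
lemma iwasawa (g : S.GG) : ∃ k ∈ C.K, ∃ d ∈ S.Hset, ∃ n ∈ S.Nset, g = k * d * n := by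
  have hb := S.bG_sq e
  have hϖ : ∀ n : ℤ, S.ϖ ^ n ≠ 0 := fun n => zpow_ne_zero _ S.unif_ne
  by_cases h0 : S.mat g 0 0 = 0
  · obtain ⟨g00, g20, -⟩ := S.mat_bG_mul e g
    have r00 := S.col_rel g 0 0
    have r02 := S.col_rel g 0 2
    simp [h0, Setting.betaM] at r00
    simp [h0, r00, Setting.betaM] at r02
    have h2 : S.mat g 2 0 ≠ 0 := left_ne_zero_of_mul_eq_one r02
    obtain ⟨n', d, n, a, b, x, y, hg, hab, hn', hxy, hn, hd, -, hb', -⟩ :=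
      S.exists_eq_n'_mul_diag_mul_n (g := S.bG e * g) (by rw [g00]; exact mul_ne_zero (hϖ _) h2)
    rw [g20, h0, mul_zero, zero_mul] at hb'
    refine ⟨S.bG e * n', C.K.mul_mem hC.bG_mem_K
      (hC.N'k_subset_K ⟨a, b, hab, hb' ▸ S.zero_mem_pE e, hn'⟩), d, hd, n, ⟨x, y, hxy, hn⟩, ?_⟩
    rw [mul_assoc, mul_assoc, ← mul_assoc n', ← hg, ← mul_assoc, hb, one_mul]
  · obtain ⟨n', d, n, a, b, x, y, hg, hab, hn', hxy, hn, hd, -⟩ :=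
      S.exists_eq_n'_mul_diag_mul_n h0
    by_cases hbe : b ∈ S.pE e
    · exact ⟨n', hC.N'k_subset_K ⟨a, b, hab, hbe, hn'⟩, d, hd, n, ⟨x, y, hxy, hn⟩, hg⟩
    · have hb0 : b ≠ 0 := fun h => hbe (h ▸ S.zero_mem_pE _)
      obtain ⟨g00, g20, -⟩ := S.mat_bG_mul e n'
      have e00 : S.mat n' 0 0 = 1 := by simp [hn', Setting.n'M]
      have e20 : S.mat n' 2 0 = b := by simp [hn', Setting.n'M]
      rw [e20] at g00
      rw [e00, mul_one] at g20
      obtain ⟨n₁, d₁, n₂, a₁, b₁, x₁, y₁, hg₁, hab₁, hn₁, hxy₁, hn₂, hd₁, -, hb₁, -⟩ :=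
        S.exists_eq_n'_mul_diag_mul_n (g := S.bG e * n') (by
          rw [g00]; exact mul_ne_zero (hϖ _) hb0)
      have hb₁' : b₁ = S.ϖ ^ (2 * e) * b⁻¹ := by
        rw [hb₁, g00, g20, mul_inv, zpow_neg, inv_inv, two_mul, zpow_add₀ S.unif_ne, mul_assoc]
      have hb₁e : b₁ ∈ S.pE e := by
        rw [hb₁']
        exact S.pE_mono (by omega) (S.mul_mem_pE (S.zpow_mem_pE le_rfl) (S.inv_mem_pE hbe) rfl)
      have hdd := S.Hset_conj_mem_Nset (S.Hset_inv hd) (n := n₂) ⟨x₁, y₁, hxy₁, hn₂⟩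
      rw [inv_inv] at hdd
      refine ⟨S.bG e * n₁, C.K.mul_mem hC.bG_mem_K
        (hC.N'k_subset_K ⟨a₁, b₁, hab₁, hb₁e, hn₁⟩), d₁ * d, S.Hset_mul hd₁ hd,
        d⁻¹ * n₂ * d * n, S.Nset_mul hdd ⟨x, y, hxy, hn⟩, ?_⟩
      have hn'' : n' = S.bG e * (n₁ * d₁ * n₂) := by
        rw [← hg₁, ← mul_assoc, hb, one_mul]
      rw [hg, hn'']
      group

/-- The decomposition of `G` into cosets represented by powers of `α`. -/
lemma cartan (g : S.GG) : ∃ k ∈ C.K, ∃ (m : ℤ) (w : S.GG),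
    (w ∈ S.NkSub (-e) ∨ w ∈ S.N'k (1 + e)) ∧ g = k * S.aG m * w := by
  obtain ⟨k, hk, d, hd, n, hn, rfl⟩ := hC.iwasawa g
  obtain ⟨h, m, hh, rfl⟩ := S.exists_eq_integralDiag_mul_aG hd
  have hb := S.bG_sq e
  have hkh := C.K.mul_mem hk (hC.diag_mem_K hh)
  obtain ⟨x, y, hxy, hm⟩ := hn
  by_cases hy : y ∈ S.pE (-e)
  · exact ⟨k * h, hkh, m, n, Or.inl ⟨x, y, hxy, hy, hm⟩, by group⟩
  by_cases hy' : y ∈ S.pE (-e + 2 * m)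
  · have h1 := S.aG_conj_N (m := -m) (g := n) ⟨x, y, hxy, hy', hm⟩
    rw [neg_neg, show -e + 2 * m + 2 * -m = -e by ring] at h1
    refine ⟨k * h * (S.aG m * n * S.aG (-m)), C.K.mul_mem hkh (hC.NkSub_le_K h1), m, 1,
      Or.inl (one_mem _), ?_⟩
    have h2 : S.aG (-m) * S.aG m = 1 := by rw [S.aG_mul_aG, neg_add_cancel, S.aG_zero]
    rw [mul_one, mul_assoc (k * h), mul_assoc _ (S.aG (-m)), h2, mul_one]
    group
  · obtain ⟨g00, g20, g02⟩ := S.mat_mul_bG e n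
    have e00 : S.mat n 0 0 = 1 := by simp [hm, Setting.nM]
    have e02 : S.mat n 0 2 = y := by simp [hm, Setting.nM]
    have e22 : S.mat n 2 2 = 1 := by simp [hm, Setting.nM]
    rw [e02] at g00
    rw [e22, one_mul] at g20
    rw [e00, one_mul] at g02
    have hy0 : y ≠ 0 := fun h => hy (h ▸ S.zero_mem_pE _)
    have hϖ : S.ϖ ^ e ≠ 0 := zpow_ne_zero _ S.unif_ne
    obtain ⟨n', d, n₁, a, b, x₁, y₁, hg, hab, hn', hxy₁, hn₁, hd, -, hb₁, hy₁⟩ :=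
      S.exists_eq_n'_mul_diag_mul_n (g := n * S.bG e) (by rw [g00]; exact mul_ne_zero hy0 hϖ)
    obtain ⟨h', j, hh', rfl⟩ := S.exists_eq_integralDiag_mul_aG hd
    have hb₁' : b = y⁻¹ := by
      rw [hb₁, g00, g20]
      field_simp
    have hy₁' : y₁ = S.ϖ ^ (-(2 * e)) * y⁻¹ := by
      rw [hy₁, g00, g02, mul_inv_rev, ← mul_assoc, ← zpow_neg, ← zpow_add₀ S.unif_ne]
      ring_nf
    have hw : S.bG e * n₁ * S.bG e ∈ S.N'k (1 + e) := by
      have h1 : n₁ ∈ S.Nk (1 - e) := ⟨x₁, y₁, hxy₁, by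
        rw [hy₁']
        exact S.mul_mem_pE (S.zpow_mem_pE le_rfl) (S.inv_mem_pE hy) (by ring), hn₁⟩
      have := S.bG_conj_N (e := e) h1
      rwa [show 1 - e + 2 * e = 1 + e by ring] at this
    have hk' : S.aG m * n' * S.aG (-m) ∈ C.K := by
      have h1 : n' ∈ S.N'k (1 - (-e + 2 * m)) := ⟨a, b, hab, hb₁' ▸ S.inv_mem_pE hy', hn'⟩
      have := S.aG_conj_N' (m := m) h1
      rw [show 1 - (-e + 2 * m) + 2 * m = 1 + e by ring] at this
      exact hC.N'k_subset_K (S.N'k_subset (by omega) this)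
    refine ⟨k * h * (S.aG m * n' * S.aG (-m)) * h' * S.bG e, C.K.mul_mem (C.K.mul_mem
      (C.K.mul_mem hkh hk') (hC.diag_mem_K hh')) hC.bG_mem_K, -(m + j), _, Or.inr hw, ?_⟩
    have hn2 : n = n' * (h' * S.aG j) * n₁ * S.bG e := by
      rw [← hg, mul_assoc, hb, mul_one]
    have hcomm := S.diag_mul_comm (S.aG_mem_Hset (-m)) (hh'.mem_Hset)
    have h1 : S.bG e * S.aG (-(m + j)) = S.aG m * S.aG j * S.bG e := by
      rw [S.aG_mul_aG, S.aG_mul_bG]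
    have h2 : S.aG (-m) * S.aG m = 1 := by rw [S.aG_mul_aG, neg_add_cancel, S.aG_zero]
    calc k * (h * S.aG m) * n
        = k * h * S.aG m * n' * h' * S.aG j * n₁ * S.bG e := by
          rw [hn2]; simp only [mul_assoc]
      _ = k * h * S.aG m * n' * h' * (S.aG (-m) * S.aG m) * S.aG j * (S.bG e * S.bG e) * n₁ *
            S.bG e := by rw [h2, hb]; simp only [mul_one]
      _ = k * h * S.aG m * n' * (h' * S.aG (-m)) * (S.aG m * S.aG j * S.bG e) *
            (S.bG e * n₁ * S.bG e) := by simp only [mul_assoc]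
      _ = _ := by rw [← hcomm, ← h1]; simp only [mul_assoc]

end Chamber.HasParam

section Homs

variable {S : Setting} {C : Chamber S} {e : ℤ}
variable {𝔽 : Type} [Field 𝔽] {W : Type} [AddCommGroup W] [Module 𝔽 W]
variable {σ : Representation 𝔽 ↥C.K W}

lemma sigma'_coe (k : ↥C.K) : sigma' C 𝔽 W σ (k : S.GG) = σ k := dif_pos k.2

lemma IsWeight.trivOn (hσ : IsWeight C 𝔽 W σ) (hC : C.HasParam e) : hC.datum.TrivOn σ :=
  fun u hu => hσ.2.2.2 u u.2 (hC.Nk_subset_KoneS hu)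

lemma IsChi.isEigen (hC : C.HasParam e) {v : W} (hv : ∀ g ∈ C.I1, sigma' C 𝔽 W σ g v = v)
    {χ : S.GG → 𝔽} (hχ : IsChi C 𝔽 W σ v χ) : hC.datum.IsEigen σ (fun h => χ h) v := by
  refine ⟨fun u hu => ?_, fun h hh => ?_⟩
  · rw [← sigma'_coe]
    exact hv _ (hC.Nk_subset_I1 hu)
  · rw [← sigma'_coe]
    exact hχ _ ((hC.mem_H0 _).mpr hh)

/-- A function in `ind_K^G σ` generating a weight whose character is the swap of that of `σ`
vanishes at the powers of `α`. -/
lemma apply_aG_eq_zero (hp : (S.p : 𝔽) = 0) (hC : C.HasParam e) (hσ : IsWeight C 𝔽 W σ)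
    {v : W} (hv0 : v ≠ 0) {χ : ↥C.K → 𝔽} (hv : hC.datum.IsEigen σ χ v)
    (hreg : ∃ h ∈ hC.datum.H, χ h ≠ χ (hC.datum.β * h * hC.datum.β))
    {W' : Type} [AddCommGroup W'] [Module 𝔽 W'] {σ' : Representation 𝔽 ↥C.K W'}
    (hσ' : IsWeight C 𝔽 W' σ') {v' : W'}
    (hv' : hC.datum.IsEigen σ' (fun h => χ (hC.datum.β * h * hC.datum.β)) v')
    {ψ : W' →ₗ[𝔽] ↥(IndSub C 𝔽 W σ)}
    (hψ : ∀ (k : ↥C.K) (w : W'), ψ (σ' k w) = indRep C 𝔽 W σ ↑k (ψ w)) (m : ℤ) :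
    (ψ v' : S.GG → W) (S.aG m) = 0 := by
  have hleft : ∀ (k : ↥C.K) (w : W') (g : S.GG),
      (ψ w : S.GG → W) (k * g) = σ k ((ψ w : S.GG → W) g) := fun k w g => (ψ w).2.1 k k.2 g
  have hright : ∀ (k : ↥C.K) (w : W') (g : S.GG),
      (ψ w : S.GG → W) (g * k) = (ψ (σ' k w) : S.GG → W) g := fun k w g => by
    rw [hψ]
    rfl
  have hnonneg : ∀ n : ℤ, 0 ≤ n → (ψ v' : S.GG → W) (S.aG n) = 0 := by
    intro n hn
    refine hC.datum.eigen_swap_eq_zero S.hp hp (hσ.trivOn hC) hσ.2.2.1 hreg hv hv0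
      ⟨fun u hu => ?_, fun h hh => ?_⟩
    · have h1 : S.aG (-n) * u * S.aG n ∈ S.NkSub (-e) :=
        S.NkSub_mono (by omega) (S.aG_conj_N (k := -e) hu)
      have h2 : S.aG n * S.aG (-n) = 1 := by rw [S.aG_mul_aG, add_neg_cancel, S.aG_zero]
      have h3 := hright ⟨_, hC.NkSub_le_K h1⟩ v' (S.aG n)
      rw [hv'.1 _ h1, ← mul_assoc, ← mul_assoc, h2, one_mul, hleft] at h3
      exact h3
    · rw [← hleft, S.diag_mul_comm (Setting.IsIntegralDiag.mem_Hset S hh) (S.aG_mem_Hset n),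
        hright, hv'.2 h hh, map_smul]
      rfl
  rcases le_or_gt 0 m with hm | hm
  · exact hnonneg m hm
  obtain ⟨n, rfl⟩ : ∃ n, m = -n := ⟨-m, by ring⟩
  have hn : 0 < n := by omega
  have hT : hC.datum.T σ' v' = 0 := by
    refine hC.datum.T_eq_zero S.hp hp (hσ'.trivOn hC) hσ'.2.2.1 ?_ hv'
    obtain ⟨h, hh, hne⟩ := hreg
    refine ⟨h, hh, fun heq => hne ?_⟩
    rw [heq]
    congr 1
    simp only [← mul_assoc]
    rw [hC.datum.β_sq, one_mul, mul_assoc, hC.datum.β_sq, mul_one]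
  have hsum : ∑ c : hC.datum.Quo,
      (ψ (σ' (hC.datum.rep c * hC.datum.β) v') : S.GG → W) (S.aG n) = 0 := by
    have h1 := congrArg (fun w => (ψ w : S.GG → W) (S.aG n)) hT
    simpa [RankOneDatum.T_apply, Finset.sum_apply] using h1
  have hterm : ∀ c : hC.datum.Quo, c ≠ 1 →
      (ψ (σ' (hC.datum.rep c * hC.datum.β) v') : S.GG → W) (S.aG n) = 0 := by
    intro c hc
    obtain ⟨u, hu, h, hh, z, hz, heq⟩ :=
      hC.datum.big_cell _ (hC.datum.rep_mem c) (hC.datum.rep_not_mem hc)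
    have h1 : S.bG e * u * S.bG e ∈ S.N'k (-e + 2 * e) := S.bG_conj_N hu
    have h2 := hC.N'k_subset_K (S.N'k_subset (by omega) (S.aG_conj_N' (m := n) h1))
    have h3 : S.aG (-n) * S.aG n = 1 := by rw [S.aG_mul_aG, neg_add_cancel, S.aG_zero]
    have h4 := hleft ⟨_, h2⟩ v' (S.aG n)
    rw [hnonneg n hn.le, map_zero, mul_assoc _ (S.aG (-n)), h3, mul_one] at h4
    rw [heq, map_mul, map_mul, Module.End.mul_apply, Module.End.mul_apply, hv'.1 z hz,
      hv'.2 h hh, map_smul, map_smul]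
    change (_ : 𝔽) • (ψ (σ' (hC.datum.β * u * hC.datum.β) v') : S.GG → W) (S.aG n) = 0
    rw [← hright]
    change (_ : 𝔽) • (ψ v' : S.GG → W) (S.aG n * (S.bG e * u * S.bG e)) = 0
    rw [h4, smul_zero]
  have hone : (ψ (σ' (hC.datum.rep 1 * hC.datum.β) v') : S.GG → W) (S.aG n) =
      σ hC.datum.β ((ψ v' : S.GG → W) (S.aG (-n))) := by
    rw [map_mul, hσ'.trivOn hC _ hC.datum.rep_one_mem, one_mul, ← hright, ← hleft]
    exact congrArg _ (S.aG_mul_bG n e)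
  rw [Finset.sum_eq_single 1 (fun c _ hc => hterm c hc) (by simp), hone] at hsum
  have h5 := congrArg (σ hC.datum.β) hsum
  rwa [map_zero, ← Module.End.mul_apply, ← map_mul, hC.datum.β_sq, map_one] at h5

lemma weight_hom_eq_zero (hp : (S.p : 𝔽) = 0) (hC : C.HasParam e) (hσ : IsWeight C 𝔽 W σ)
    {v : W} (hv0 : v ≠ 0) {χ : ↥C.K → 𝔽} (hv : hC.datum.IsEigen σ χ v)
    (hreg : ∃ h ∈ hC.datum.H, χ h ≠ χ (hC.datum.β * h * hC.datum.β))
    {W' : Type} [AddCommGroup W'] [Module 𝔽 W'] {σ' : Representation 𝔽 ↥C.K W'}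
    (hσ' : IsWeight C 𝔽 W' σ') {v' : W'} (hv0' : v' ≠ 0)
    (hv' : hC.datum.IsEigen σ' (fun h => χ (hC.datum.β * h * hC.datum.β)) v')
    {ψ : W' →ₗ[𝔽] ↥(IndSub C 𝔽 W σ)}
    (hψ : ∀ (k : ↥C.K) (w : W'), ψ (σ' k w) = indRep C 𝔽 W σ ↑k (ψ w)) : ψ = 0 := by
  have hzero : ψ v' = 0 := by
    refine Subtype.ext (funext fun g => ?_)
    obtain ⟨k, hk, m, w, hw, rfl⟩ := hC.cartan g
    have hright : ∀ k : ↥C.K, σ' k v' = v' → (ψ v' : S.GG → W) (S.aG m * k) = 0 := by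
      intro k hk
      have h1 : (ψ v' : S.GG → W) (S.aG m * k) = (ψ (σ' k v') : S.GG → W) (S.aG m) := by
        rw [hψ]
        rfl
      rw [h1, hk, apply_aG_eq_zero hp hC hσ hv0 hv hreg hσ' hv' hψ]
    have hfix : (ψ v' : S.GG → W) (S.aG m * w) = 0 := by
      rcases hw with hw | hw
      · exact hright ⟨w, hC.NkSub_le_K hw⟩ (hv'.1 _ hw)
      · refine hright ⟨w, hC.N'k_subset_K (S.N'k_subset (by omega) hw)⟩ ?_
        have h1 := S.bG_conj_N' (e := e) hw
        rw [show 1 + e - 2 * e = 1 - e by ring] at h1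
        obtain ⟨k, hk⟩ : ∃ k : ↥C.K, k = ⟨w, hC.N'k_subset_K (S.N'k_subset (by omega) hw)⟩ :=
          ⟨_, rfl⟩
        rw [← hk]
        have h2 : σ' (hC.datum.β * k * hC.datum.β) = 1 :=
          hσ'.trivOn hC _ (by rw [hk]; exact h1)
        have h3 : k = hC.datum.β * (hC.datum.β * k * hC.datum.β) * hC.datum.β := by
          simp only [← mul_assoc]
          rw [hC.datum.β_sq, one_mul, mul_assoc, hC.datum.β_sq, mul_one]
        rw [h3, map_mul, map_mul, h2, mul_one, ← map_mul, hC.datum.β_sq, map_one]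
        rfl
    rw [mul_assoc, (ψ v').2.1 k hk, hfix, map_zero]
    rfl
  have hker : LinearMap.ker ψ = ⊥ ∨ LinearMap.ker ψ = ⊤ :=
    hσ'.2.2.1 _ fun k w hw => by
      rw [LinearMap.mem_ker] at hw ⊢
      rw [hψ, hw, map_zero]
  rcases hker with h | h
  · exact absurd ((Submodule.mem_bot 𝔽).mp (h ▸ LinearMap.mem_ker.mpr hzero)) hv0'
  · exact LinearMap.ker_eq_top.mp h

lemma stdFn_one_apply (v : W) (x : S.GG) :
    stdFn C 𝔽 W σ 1 v x = if h : x ∈ C.K then σ ⟨x, h⟩ v else 0 := by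
  simp only [stdFn, mul_one]

variable (σ) in
/-- The `K`-equivariant embedding `v ↦ [1, v]` of `σ` in `ind_K^G σ`. -/
def stdHom : W →ₗ[𝔽] ↥(IndSub C 𝔽 W σ) where
  toFun v := ⟨stdFn C 𝔽 W σ 1 v, by
    refine ⟨fun k hk g => ?_, {1}, fun g hg => ?_⟩
    · rw [stdFn_one_apply, stdFn_one_apply]
      by_cases h : g ∈ C.K
      · rw [dif_pos h, dif_pos (C.K.mul_mem hk h), ← Module.End.mul_apply, ← map_mul]
        rfl
      · rw [dif_neg h, dif_neg (fun h' => h ((C.K.mul_mem_cancel_left hk).mp h')), map_zero]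
    · rw [stdFn_one_apply] at hg
      by_cases h : g ∈ C.K
      · exact ⟨g, h, 1, Finset.mem_singleton_self 1, (mul_one g).symm⟩
      · exact absurd (dif_neg h) hg⟩
  map_add' v w := Subtype.ext (funext fun x => by
    change stdFn C 𝔽 W σ 1 (v + w) x = stdFn C 𝔽 W σ 1 v x + stdFn C 𝔽 W σ 1 w x
    simp only [stdFn_one_apply]
    split <;> simp)
  map_smul' c v := Subtype.ext (funext fun x => by
    change stdFn C 𝔽 W σ 1 (c • v) x = c • stdFn C 𝔽 W σ 1 v x
    simp only [stdFn_one_apply]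
    split <;> simp)

lemma stdHom_apply_of_mem (v : W) {x : S.GG} (h : x ∈ C.K) :
    (stdHom σ v : S.GG → W) x = σ ⟨x, h⟩ v :=
  (stdFn_one_apply v x).trans (dif_pos h)

lemma stdHom_apply_of_not_mem (v : W) {x : S.GG} (h : x ∉ C.K) :
    (stdHom σ v : S.GG → W) x = 0 :=
  (stdFn_one_apply v x).trans (dif_neg h)

lemma stdHom_equivariant (k : ↥C.K) (v : W) :
    stdHom σ (σ k v) = indRep C 𝔽 W σ ↑k (stdHom σ v) := by
  refine Subtype.ext (funext fun x => ?_)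
  change _ = (stdHom σ v : S.GG → W) (x * k)
  by_cases h : x ∈ C.K
  · rw [stdHom_apply_of_mem _ h, stdHom_apply_of_mem _ (C.K.mul_mem h k.2),
      ← Module.End.mul_apply, ← map_mul]
    rfl
  · rw [stdHom_apply_of_not_mem _ h,
      stdHom_apply_of_not_mem _ (fun h' => h ((C.K.mul_mem_cancel_right k.2).mp h'))]

/-- Frobenius reciprocity: an equivariant map on `ind_K^G σ` that vanishes on the functions
supported on `K` is zero. -/
lemma eq_zero_of_comp_stdHom {V : Type} [AddCommGroup V] [Module 𝔽 V]
    {ρ : Representation 𝔽 S.GG V} {φ : ↥(IndSub C 𝔽 W σ) →ₗ[𝔽] V}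
    (hφ : ∀ g x, φ (indRep C 𝔽 W σ g x) = ρ g (φ x)) (h : φ ∘ₗ stdHom σ = 0) : φ = 0 := by
  have key : ∀ (s : Finset S.GG) (f : ↥(IndSub C 𝔽 W σ)),
      (∀ g, (f : S.GG → W) g ≠ 0 → ∃ k ∈ C.K, ∃ t ∈ s, g = k * t) → φ f = 0 := by
    intro s
    induction s using Finset.induction_on with
    | empty =>
      intro f hf
      have : f = 0 := Subtype.ext (funext fun g => by
        by_contra hg
        obtain ⟨k, hk, t, ht, -⟩ := hf g hg
        exact absurd ht (Finset.notMem_empty t))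
      rw [this, map_zero]
    | insert t s _ ih =>
      intro f hf
      obtain ⟨f₁, hf₁⟩ : ∃ f₁, f₁ = indRep C 𝔽 W σ t⁻¹ (stdHom σ ((f : S.GG → W) t)) := ⟨_, rfl⟩
      have hval : ∀ g, (f₁ : S.GG → W) g =
          (stdHom σ ((f : S.GG → W) t) : S.GG → W) (g * t⁻¹) := fun g => by rw [hf₁]; rfl
      have h1 : φ f₁ = 0 := by
        rw [hf₁, hφ, show φ (stdHom σ _) = 0 from LinearMap.congr_fun h _, map_zero]
      have h2 : φ (f - f₁) = 0 := by
        refine ih _ fun g hg => ?_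
        replace hg : (f : S.GG → W) g - (f₁ : S.GG → W) g ≠ 0 := hg
        by_cases hgt : g * t⁻¹ ∈ C.K
        · refine absurd ?_ hg
          rw [hval, stdHom_apply_of_mem _ hgt, ← f.2.1, inv_mul_cancel_right, sub_self]
        · rw [hval, stdHom_apply_of_not_mem _ hgt, sub_zero] at hg
          obtain ⟨k, hk, t', ht', rfl⟩ := hf g hg
          rcases Finset.mem_insert.mp ht' with rfl | ht'
          · rw [mul_inv_cancel_right] at hgt
            exact absurd hk hgt
          · exact ⟨k, hk, t', ht', rfl⟩
      rw [map_sub, h1, sub_zero] at h2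
      exact h2
  refine LinearMap.ext fun f => ?_
  obtain ⟨s, hs⟩ := f.2.2
  exact key s f hs

end Homs

/-- If `χ_σ ≠ χ_σ^s` and `χ_{σ'} = χ_σ^s` then
`Hom_G(ind_K^G σ, ind_K^G σ') = 0`; in particular `ind_K^G σ` contains no weight `σ'`
with `χ_{σ'} = χ_σ^s`. -/
theorem stmt9
    (S : Setting) (C : Chamber S)
    (𝔽 : Type) [Field 𝔽] [IsAlgClosed 𝔽] [Algebra (ZMod S.p) 𝔽]
    [Algebra.IsAlgebraic (ZMod S.p) 𝔽]
    (W : Type) [AddCommGroup W] [Module 𝔽 W]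
    (σ : Representation 𝔽 ↥C.K W) (hσ : IsWeight C 𝔽 W σ)
    (v0 : W) (hv0 : v0 ≠ 0) (hv0inv : ∀ g ∈ C.I1, sigma' C 𝔽 W σ g v0 = v0)
    (χ : S.GG → 𝔽) (hχ : IsChi C 𝔽 W σ v0 χ)
    (hreg : ∃ h ∈ C.H0, χ h ≠ χ (C.βK * h * C.βK))
    (W' : Type) [AddCommGroup W'] [Module 𝔽 W']
    (σ' : Representation 𝔽 ↥C.K W') (hσ' : IsWeight C 𝔽 W' σ')
    (v0' : W') (hv0' : v0' ≠ 0) (hv0inv' : ∀ g ∈ C.I1, sigma' C 𝔽 W' σ' g v0' = v0')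
    (χ' : S.GG → 𝔽) (hχ' : IsChi C 𝔽 W' σ' v0' χ')
    (hχs : ∀ h ∈ C.H0, χ' h = χ (C.βK * h * C.βK)) :
    (∀ φ : ↥(IndSub C 𝔽 W σ) →ₗ[𝔽] ↥(IndSub C 𝔽 W' σ'),
      (∀ g x, φ (indRep C 𝔽 W σ g x) = indRep C 𝔽 W' σ' g (φ x)) → φ = 0) ∧
    (∀ ψ : W' →ₗ[𝔽] ↥(IndSub C 𝔽 W σ),
      (∀ (k : ↥C.K) (w : W'), ψ (σ' k w) = indRep C 𝔽 W σ ↑k (ψ w)) → ψ = 0) := by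
  obtain ⟨e, hC⟩ := C.exists_hasParam
  have hp : (S.p : 𝔽) = 0 := by
    rw [← map_natCast (algebraMap (ZMod S.p) 𝔽), ZMod.natCast_self, map_zero]
  have hβ : C.βK = hC.datum.β := hC.βK_eq
  have hswap : ∀ h : ↥C.K,
      hC.datum.β * (hC.datum.β * h * hC.datum.β) * hC.datum.β = h := fun h => by
    simp only [← mul_assoc]
    rw [hC.datum.β_sq, one_mul, mul_assoc, hC.datum.β_sq, mul_one]
  have hreg' : ∃ h ∈ hC.datum.H, χ (h : ↥C.K) ≠ χ ↑(hC.datum.β * h * hC.datum.β) := by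
    obtain ⟨h, hh, hne⟩ := hreg
    have hd := (hC.mem_H0 h).mp hh
    refine ⟨⟨h, hC.diag_mem_K hd⟩, hd, fun heq => hne ?_⟩
    rw [hβ]
    exact heq
  have hv : hC.datum.IsEigen σ (fun h => χ h) v0 := hχ.isEigen hC hv0inv
  have hv' : hC.datum.IsEigen σ' (fun h => χ ↑(hC.datum.β * h * hC.datum.β)) v0' := by
    refine ⟨(hχ'.isEigen hC hv0inv').1, fun h hh => ?_⟩
    rw [(hχ'.isEigen hC hv0inv').2 h hh]
    change χ' h • v0' = _
    rw [hχs h ((hC.mem_H0 _).mpr hh), hβ]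
    rfl
  refine ⟨fun φ hφ => eq_zero_of_comp_stdHom hφ ?_,
    fun ψ hψ => weight_hom_eq_zero hp hC hσ hv0 hv hreg' hσ' hv0' hv' hψ⟩
  refine weight_hom_eq_zero hp hC hσ' hv0' hv' ?_ hσ hv0 (v' := v0) ?_ fun k w => ?_
  · obtain ⟨h, hh, hne⟩ := hreg'
    exact ⟨h, hh, fun heq => hne (by simpa only [hswap] using heq.symm)⟩
  · simpa only [hswap] using hv
  · rw [LinearMap.comp_apply, stdHom_equivariant, hφ]
    rfl

end U21
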